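/- arXiv:quant-ph/9805082 — 8 statements merged into one kernel-verified Lean document; each statement's English description precedes it below -/
import Mathlib

section
/- Let φ and ϕ be complex numbers of unit norm and Q = Q(A,G,φ,ϕ). Then for every υ_a ∈ G one has Q υ_a = −ϕ·υ_a + ϕ(1−φ)·⟪A e₀, υ_a⟫·(A e₀), and for every υ_b in the orthogonal complement of G one has Q υ_b = −υ_b + (1−φ)·⟪A e₀, υ_b⟫·(A e₀). -/
open scoped InnerProductSpace

/-- The phase-shift operator `S_K^φ = id − (1−φ)·(orthogonal projection onto K)`. -/
noncomputable def Sop {E : Type*} [NormedAddCommGroup E] [InnerProductSpace ℂ E]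
    [FiniteDimensional ℂ E] (K : Submodule ℂ E) (φ : ℂ) (x : E) : E :=
  x - (1 - φ) • (Submodule.orthogonalProjectionOnto K x : E)

/-- The amplitude amplification operator `Q(A,G,φ,ϕ) = −A ∘ S₀^φ ∘ A⁻¹ ∘ S_G^ϕ`. -/
noncomputable def ampQ {E : Type*} [NormedAddCommGroup E] [InnerProductSpace ℂ E]
    [FiniteDimensional ℂ E] (A : E ≃ₗᵢ[ℂ] E) (e₀ : E) (G : Submodule ℂ E)
    (φ ϕ : ℂ) (x : E) : E :=
  - A (Sop (ℂ ∙ e₀) φ (A.symm (Sop G ϕ x)))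

/-- Conjugating `S₀^φ` by `A` gives the phase shift along the unit vector `A e₀`. -/
theorem ampQ_eq_of_norm_eq_one {E : Type*} [NormedAddCommGroup E] [InnerProductSpace ℂ E]
    [FiniteDimensional ℂ E] (A : E ≃ₗᵢ[ℂ] E) {e₀ : E} (he₀ : ‖e₀‖ = 1) (G : Submodule ℂ E)
    (φ ϕ : ℂ) (x : E) :
    ampQ A e₀ G φ ϕ x
      = -Sop G ϕ x + (1 - φ) • (⟪A e₀, Sop G ϕ x⟫_ℂ • A e₀) := by
  have h (y : E) : (Submodule.orthogonalProjectionOnto (ℂ ∙ e₀) y : E) = ⟪e₀, y⟫_ℂ • e₀ :=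
    Submodule.starProjection_unit_singleton ℂ he₀ y
  have hA (y : E) : ⟪e₀, A.symm y⟫_ℂ = ⟪A e₀, y⟫_ℂ := by
    rw [← A.inner_map_map, A.apply_symm_apply]
  rw [ampQ, Sop, h, hA, map_sub, map_smul, map_smul, A.apply_symm_apply, neg_sub, sub_eq_neg_add]

theorem Sop_of_mem {E : Type*} [NormedAddCommGroup E] [InnerProductSpace ℂ E]
    [FiniteDimensional ℂ E] {K : Submodule ℂ E} (φ : ℂ) {x : E} (hx : x ∈ K) :
    Sop K φ x = φ • x := by
  have h : (Submodule.orthogonalProjectionOnto K x : E) = x :=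
    Submodule.starProjection_eq_self_iff.2 hx
  rw [Sop, h]
  module

theorem Sop_of_mem_orthogonal {E : Type*} [NormedAddCommGroup E] [InnerProductSpace ℂ E]
    [FiniteDimensional ℂ E] {K : Submodule ℂ E} (φ : ℂ) {x : E} (hx : x ∈ Kᗮ) :
    Sop K φ x = x := by
  have h : (Submodule.orthogonalProjectionOnto K x : E) = 0 :=
    (Submodule.starProjection_apply_eq_zero_iff K).2 hx
  rw [Sop, h, smul_zero, sub_zero]

/-- For `υ_a ∈ G`, `Q υ_a = −ϕ·υ_a + ϕ(1−φ)·⟪A e₀, υ_a⟫·(A e₀)`, and for `υ_b ∈ Gᗮ`,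
`Q υ_b = −υ_b + (1−φ)·⟪A e₀, υ_b⟫·(A e₀)`. -/
theorem stmt1 {E : Type*} [NormedAddCommGroup E] [InnerProductSpace ℂ E]
    [FiniteDimensional ℂ E]
    (A : E ≃ₗᵢ[ℂ] E) (e₀ : E) (he₀ : ‖e₀‖ = 1) (G : Submodule ℂ E)
    (φ ϕ : ℂ) (hφ : ‖φ‖ = 1) (hϕ : ‖ϕ‖ = 1) :
    (∀ υa ∈ G, ampQ A e₀ G φ ϕ υa
        = -ϕ • υa + (ϕ * (1 - φ)) • (⟪A e₀, υa⟫_ℂ • A e₀)) ∧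
    (∀ υb ∈ Gᗮ, ampQ A e₀ G φ ϕ υb
        = -υb + (1 - φ) • (⟪A e₀, υb⟫_ℂ • A e₀)) := by
  refine ⟨fun υa ha => ?_, fun υb hb => ?_⟩
  · rw [ampQ_eq_of_norm_eq_one A he₀, Sop_of_mem ϕ ha, inner_smul_right]
    module
  · rw [ampQ_eq_of_norm_eq_one A he₀, Sop_of_mem_orthogonal ϕ hb]
end

section
/- Let Q = Q(A,G,−1,−1) (i.e., both phase factors equal −1). Then Q ψ_a = (1−2a)·ψ_a − 2a·ψ_b and Q ψ_b = 2(1−a)·ψ_a + (1−2a)·ψ_b, where a = ‖ψ_a‖². -/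
open scoped InnerProductSpace

theorem ampQ_neg_one_apply {E : Type*} [NormedAddCommGroup E] [InnerProductSpace ℂ E]
    [FiniteDimensional ℂ E] (A : E ≃ₗᵢ[ℂ] E) {e₀ : E} (he₀ : ‖e₀‖ = 1) (G : Submodule ℂ E)
    (ϕ : ℂ) (x : E) :
    ampQ A e₀ G (-1) ϕ x = (2 * ⟪A e₀, Sop G ϕ x⟫_ℂ) • A e₀ - Sop G ϕ x := by
  have h : ⟪e₀, A.symm (Sop G ϕ x)⟫_ℂ = ⟪A e₀, Sop G ϕ x⟫_ℂ := by
    rw [← A.inner_map_map, A.apply_symm_apply]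
  unfold ampQ
  rw [Sop, Submodule.coe_orthogonalProjectionOnto_apply,
    Submodule.starProjection_unit_singleton ℂ he₀, h, map_sub, map_smul, map_smul, A.apply_symm_apply]
  module

/-- With both phase factors equal to `−1`:
`Q ψ_a = (1−2a)·ψ_a − 2a·ψ_b` and `Q ψ_b = 2(1−a)·ψ_a + (1−2a)·ψ_b`, where `a = ‖ψ_a‖²`. -/
theorem stmt3 {E : Type*} [NormedAddCommGroup E] [InnerProductSpace ℂ E]
    [FiniteDimensional ℂ E]
    (A : E ≃ₗᵢ[ℂ] E) (e₀ : E) (he₀ : ‖e₀‖ = 1) (G : Submodule ℂ E)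
    (ψ ψa ψb : E) (a : ℝ)
    (hψ : ψ = A e₀) (hψa : ψa = (Submodule.orthogonalProjectionOnto G ψ : E)) (hψb : ψb = ψ - ψa)
    (ha : a = ‖ψa‖ ^ 2) :
    ampQ A e₀ G (-1) (-1) ψa
        = ((1 - 2 * a : ℝ) : ℂ) • ψa - ((2 * a : ℝ) : ℂ) • ψb ∧
    ampQ A e₀ G (-1) (-1) ψb
        = ((2 * (1 - a) : ℝ) : ℂ) • ψa + ((1 - 2 * a : ℝ) : ℂ) • ψb := by
  have hmem : ψa ∈ G := hψa ▸ Submodule.coe_mem _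
  have hPa : (G.orthogonalProjectionOnto ψa : E) = ψa :=
    Submodule.starProjection_eq_self_iff.mpr hmem
  have hSa : Sop G (-1) ψa = -ψa := by
    rw [Sop, hPa]
    module
  have hproj : (G.orthogonalProjectionOnto ψb : E) = 0 := by
    rw [hψb, map_sub, Submodule.coe_sub, hPa, ← hψa, sub_self]
  have hSb : Sop G (-1) ψb = ψb := by
    rw [Sop, hproj, smul_zero, sub_zero]
  have hba : ⟪ψb, ψa⟫_ℂ = 0 := by
    rw [hψb, hψa]
    exact Submodule.starProjection_inner_eq_zero ψ _ (Submodule.coe_mem _)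
  have hsum : ψ = ψa + ψb := by rw [hψb]; abel
  have hψψa : ⟪ψ, ψa⟫_ℂ = a := by
    rw [hsum, inner_add_left, hba, add_zero, inner_self_eq_norm_sq_to_K, ha]
    norm_cast
  have hψψ : ⟪ψ, ψ⟫_ℂ = 1 := by
    rw [hψ, A.inner_map_map, inner_self_eq_norm_sq_to_K, he₀]
    norm_num
  have hψψb : ⟪ψ, ψb⟫_ℂ = 1 - a := by
    rw [hψb, inner_sub_right, hψψ, hψψa]
  rw [ampQ_neg_one_apply A he₀, ampQ_neg_one_apply A he₀, hSa, hSb, ← hψ, inner_neg_right,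
    hψψa, hψψb]
  push_cast
  constructor <;> rw [hsum] <;> module
end

section
/- Let φ and ϕ be complex numbers of unit norm and Q = Q(A,G,φ,ϕ). For any vector υ ∈ E, write υ_a = P_G υ and υ_b = υ − υ_a. Then the linear subspace of E spanned by the four vectors υ_a, υ_b, ψ_a, ψ_b is invariant under the action of Q. -/
open scoped InnerProductSpace

/-- A phase shift along `K` preserves every subspace that the projection onto `K` preserves. -/
theorem Sop_mem {E : Type*} [NormedAddCommGroup E] [InnerProductSpace ℂ E]
    [FiniteDimensional ℂ E] {K W : Submodule ℂ E} (φ : ℂ) {x : E} (hx : x ∈ W)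
    (hK : (Submodule.orthogonalProjectionOnto K x : E) ∈ W) : Sop K φ x ∈ W :=
  W.sub_mem hx (W.smul_mem _ hK)

/-- The conjugate by `A` of a phase shift along `e₀` preserves every subspace containing `A e₀`. -/
theorem map_Sop_span_singleton_symm_mem {E : Type*} [NormedAddCommGroup E]
    [InnerProductSpace ℂ E] [FiniteDimensional ℂ E] (A : E ≃ₗᵢ[ℂ] E) {e₀ : E} (φ : ℂ)
    {W : Submodule ℂ E} (he₀ : A e₀ ∈ W) {y : E} (hy : y ∈ W) :
    A (Sop (ℂ ∙ e₀) φ (A.symm y)) ∈ W := by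
  obtain ⟨c, hc⟩ := Submodule.mem_span_singleton.1
    (Submodule.orthogonalProjectionOnto (ℂ ∙ e₀) (A.symm y)).2
  rw [Sop, ← hc, map_sub, map_smul, map_smul, A.apply_symm_apply]
  exact W.sub_mem hy (W.smul_mem _ (W.smul_mem _ he₀))

/-- For any vector `υ`, writing `υ_a = P_G υ` and `υ_b = υ − υ_a`, the subspace spanned by
`υ_a, υ_b, ψ_a, ψ_b` is invariant under `Q`. -/
theorem stmt4 {E : Type*} [NormedAddCommGroup E] [InnerProductSpace ℂ E]
    [FiniteDimensional ℂ E]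
    (A : E ≃ₗᵢ[ℂ] E) (e₀ : E) (he₀ : ‖e₀‖ = 1) (G : Submodule ℂ E)
    (φ ϕ : ℂ) (hφ : ‖φ‖ = 1) (hϕ : ‖ϕ‖ = 1)
    (ψ ψa ψb : E)
    (hψ : ψ = A e₀) (hψa : ψa = (Submodule.orthogonalProjectionOnto G ψ : E)) (hψb : ψb = ψ - ψa)
    (υ υa υb : E)
    (hυa : υa = (Submodule.orthogonalProjectionOnto G υ : E)) (hυb : υb = υ - υa) :
    ∀ x ∈ Submodule.span ℂ ({υa, υb, ψa, ψb} : Set E),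
      ampQ A e₀ G φ ϕ x ∈ Submodule.span ℂ ({υa, υb, ψa, ψb} : Set E) := by
  set W := Submodule.span ℂ ({υa, υb, ψa, ψb} : Set E)
  have hυaW : υa ∈ W := Submodule.subset_span (by simp)
  have hψaW : ψa ∈ W := Submodule.subset_span (by simp)
  have hψbW : ψb ∈ W := Submodule.subset_span (by simp)
  have hψW : A e₀ ∈ W := by
    rw [← hψ, ← sub_add_cancel ψ ψa, ← hψb]
    exact W.add_mem hψbW hψaW
  have hP (v : E) : G.starProjection (G.starProjection v) = G.starProjection v :=
    Submodule.starProjection_eq_self_iff.2 (G.starProjection_apply_mem v)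
  have hGW : W ≤ W.comap G.starProjection.toLinearMap := by
    refine Submodule.span_le.2 ?_
    rintro _ (rfl | rfl | rfl | rfl)
    · simpa [hυa, hP] using hυaW
    · simp [hυb, hυa, hP]
    · simpa [hψa, hP] using hψaW
    · simp [hψb, hψa, hP]
  intro x hx
  exact W.neg_mem (map_Sop_span_singleton_symm_mem A φ hψW (Sop_mem ϕ hx (hGW hx)))
end

section
/- (Amplitude Amplification, simple case.) Let Q = Q(A,G,−1,−1), suppose 0 < a < 1 where a = ‖ψ_a‖², and let θ ∈ (0, π/2) be the angle with sin²θ = a. Then for every natural number j, Q^j ψ = k_j·ψ_a + ℓ_j·ψ_b, where k_j = sin((2j+1)θ)/√a and ℓ_j = cos((2j+1)θ)/√(1−a). -/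
open scoped InnerProductSpace

lemma Sop_apply {E : Type*} [NormedAddCommGroup E] [InnerProductSpace ℂ E]
    [FiniteDimensional ℂ E] (K : Submodule ℂ E) (φ : ℂ) (x : E) :
    Sop K φ x = x - (1 - φ) • K.starProjection x := rfl

lemma map_Sop_span_singleton_symm {E : Type*} [NormedAddCommGroup E] [InnerProductSpace ℂ E]
    [FiniteDimensional ℂ E] (A : E ≃ₗᵢ[ℂ] E) {e : E} (he : ‖e‖ = 1) (φ : ℂ) (x : E) :
    A (Sop (ℂ ∙ e) φ (A.symm x)) = x - ((1 - φ) * ⟪A e, x⟫_ℂ) • A e := by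
  have h : ⟪e, A.symm x⟫_ℂ = ⟪A e, x⟫_ℂ := by
    rw [← A.inner_map_map, A.apply_symm_apply]
  rw [Sop_apply, Submodule.starProjection_unit_singleton ℂ he, h, map_sub, map_smul, map_smul,
    A.apply_symm_apply, smul_smul]

lemma Sop_smul_add_smul {E : Type*} [NormedAddCommGroup E] [InnerProductSpace ℂ E]
    [FiniteDimensional ℂ E] {K : Submodule ℂ E} {x y : E} (hx : x ∈ K) (hy : y ∈ Kᗮ)
    (φ u v : ℂ) : Sop K φ (u • x + v • y) = (φ * u) • x + v • y := by
  rw [Sop_apply, map_add, map_smul, map_smul, Submodule.starProjection_eq_self_iff.mpr hx,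
    K.starProjection_apply y,
    Submodule.orthogonalProjectionOnto_eq_zero_iff.mpr hy, ZeroMemClass.coe_zero]
  module

/-- The action of `ampQ` with both phases `-1` on the plane spanned by the good component `x` and
the bad component `y` of the unit vector `A e`. -/
lemma ampQ_neg_one_smul_add_smul {E : Type*} [NormedAddCommGroup E] [InnerProductSpace ℂ E]
    [FiniteDimensional ℂ E] (A : E ≃ₗᵢ[ℂ] E) {e : E} (he : ‖e‖ = 1) {G : Submodule ℂ E}
    {x y : E} (hx : x ∈ G) (hy : y ∈ Gᗮ) (hxy : A e = x + y) (u v : ℂ) :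
    ampQ A e G (-1) (-1) (u • x + v • y)
      = (u * (1 - 2 * (‖x‖ : ℂ) ^ 2) + 2 * v * (1 - (‖x‖ : ℂ) ^ 2)) • x
        + (v * (1 - 2 * (‖x‖ : ℂ) ^ 2) - 2 * u * (‖x‖ : ℂ) ^ 2) • y := by
  have hxy0 : ⟪x, y⟫_ℂ = 0 := Submodule.inner_right_of_mem_orthogonal hx hy
  have hyx0 : ⟪y, x⟫_ℂ = 0 := Submodule.inner_left_of_mem_orthogonal hx hy
  have hy2 : (‖y‖ : ℂ) ^ 2 = 1 - (‖x‖ : ℂ) ^ 2 := by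
    have h : ⟪A e, A e⟫_ℂ = 1 := by simp [inner_self_eq_norm_sq_to_K, he]
    rw [hxy, inner_add_left, inner_add_right, inner_add_right, hxy0, hyx0,
      inner_self_eq_norm_sq_to_K, inner_self_eq_norm_sq_to_K] at h
    simp only [Complex.coe_algebraMap] at h
    linear_combination h
  have hin : ⟪x + y, (-1 * u) • x + v • y⟫_ℂ
      = -u * (‖x‖ : ℂ) ^ 2 + v * (1 - (‖x‖ : ℂ) ^ 2) := by
    rw [inner_add_left, inner_add_right, inner_add_right, inner_smul_right, inner_smul_right,
      inner_smul_right, inner_smul_right, hxy0, hyx0, inner_self_eq_norm_sq_to_K,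
      inner_self_eq_norm_sq_to_K]
    simp only [Complex.coe_algebraMap]
    rw [hy2]
    ring
  rw [ampQ, Sop_smul_add_smul hx hy, map_Sop_span_singleton_symm A he, hxy, hin]
  module

/-- Amplitude amplification, simple case: for all `j`,
`Q^j ψ = (sin((2j+1)θ)/√a)·ψ_a + (cos((2j+1)θ)/√(1−a))·ψ_b`, where `sin²θ = a = ‖ψ_a‖²`. -/
theorem stmt5 {E : Type*} [NormedAddCommGroup E] [InnerProductSpace ℂ E]
    [FiniteDimensional ℂ E]
    (A : E ≃ₗᵢ[ℂ] E) (e₀ : E) (he₀ : ‖e₀‖ = 1) (G : Submodule ℂ E)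
    (ψ ψa ψb : E) (a θ : ℝ)
    (hψ : ψ = A e₀) (hψa : ψa = (Submodule.orthogonalProjectionOnto G ψ : E)) (hψb : ψb = ψ - ψa)
    (ha : a = ‖ψa‖ ^ 2) (ha0 : 0 < a) (ha1 : a < 1)
    (hθ0 : 0 < θ) (hθ1 : θ < Real.pi / 2) (hθa : Real.sin θ ^ 2 = a) :
    ∀ j : ℕ,
      (ampQ A e₀ G (-1) (-1))^[j] ψ
        = ((Real.sin ((2 * j + 1) * θ) / Real.sqrt a : ℝ) : ℂ) • ψa
          + ((Real.cos ((2 * j + 1) * θ) / Real.sqrt (1 - a) : ℝ) : ℂ) • ψb := by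
  have hs : 0 < Real.sin θ := Real.sin_pos_of_pos_of_lt_pi hθ0 (by linarith [Real.pi_pos])
  have hc : 0 < Real.cos θ := Real.cos_pos_of_mem_Ioo ⟨by linarith, hθ1⟩
  have hsqrt : √a = Real.sin θ := by rw [← hθa, Real.sqrt_sq hs.le]
  have hsqrt' : √(1 - a) = Real.cos θ := by
    rw [← hθa, ← Real.cos_sq', Real.sqrt_sq hc.le]
  have hmem : ψa ∈ G := hψa ▸ Submodule.coe_mem _
  have hmem' : ψb ∈ Gᗮ := by
    rw [hψb, hψa]
    exact Submodule.sub_starProjection_mem_orthogonal ψ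
  have hadd : ψ = ψa + ψb := by rw [hψb, add_sub_cancel]
  have hnorm : (‖ψa‖ : ℂ) ^ 2 = ((Real.sin θ ^ 2 : ℝ) : ℂ) := by
    rw [hθa, ha, Complex.ofReal_pow]
  rw [hsqrt, hsqrt']
  intro j
  induction j with
  | zero => simpa [← Complex.ofReal_sin, ← Complex.ofReal_cos, hs.ne', hc.ne'] using hadd
  | succ n ih =>
    rw [Function.iterate_succ_apply', ih,
      ampQ_neg_one_smul_add_smul A he₀ hmem hmem' (hψ ▸ hadd), hnorm]
    have harg : (2 * ((n + 1 : ℕ) : ℝ) + 1) * θ = (2 * n + 1) * θ + 2 * θ := by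
      push_cast
      ring
    rw [harg, Real.sin_add, Real.cos_add, Real.sin_two_mul, Real.cos_two_mul']
    have hcs := Real.sin_sq_add_cos_sq θ
    generalize Real.sin ((2 * n + 1) * θ) = S
    generalize Real.cos ((2 * n + 1) * θ) = C
    congr 2
    · norm_cast
      field_simp
      linear_combination (-2 * Real.sin θ * C - S * Real.cos θ) * hcs
    · norm_cast
      field_simp
      rw [Real.cos_sq']
      ring
end

section
/- (Quadratic speedup.) Let Q = Q(A,G,−1,−1), suppose 0 < a ≤ 1 where a = ‖ψ_a‖², let θ ∈ (0, π/2] be the angle with sin²θ = a, and set m = ⌊π/(4θ)⌋. Then ‖P_G(Q^m ψ)‖² = sin²((2m+1)θ) ≥ max(1−a, a); that is, measuring Q^m A|0⟩ yields a good state with probability at least max(1−a, a). -/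
open scoped InnerProductSpace

section Reflections

variable {E : Type*} [NormedAddCommGroup E] [InnerProductSpace ℂ E] [FiniteDimensional ℂ E]

/-- Conjugating the reflection about `e₀` by `A` gives the reflection about `A e₀`. -/
theorem ampQ_neg_one_neg_one_apply (A : E ≃ₗᵢ[ℂ] E) (e₀ : E) (he₀ : ‖e₀‖ = 1)
    (G : Submodule ℂ E) (x : E) :
    ampQ A e₀ G (-1) (-1) x =
      (2 * ⟪A e₀, x - (2 : ℂ) • (G.orthogonalProjectionOnto x : E)⟫_ℂ) • A e₀
        - (x - (2 : ℂ) • (G.orthogonalProjectionOnto x : E)) := by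
  have hy (y : E) : ⟪e₀, A.symm y⟫_ℂ = ⟪A e₀, y⟫_ℂ := by
    rw [← A.inner_map_map, A.apply_symm_apply]
  have h2 : (1 - -1 : ℂ) = 2 := by norm_num
  unfold ampQ Sop
  rw [h2, ← Submodule.starProjection_apply (ℂ ∙ e₀), Submodule.starProjection_unit_singleton ℂ he₀,
    hy, map_sub, A.apply_symm_apply, map_smul, map_smul, smul_smul]
  abel

/-- On the plane spanned by the good and bad components of `A e₀`, the operator `Q` acts by an
explicit `2 × 2` matrix. -/
theorem ampQ_neg_one_neg_one_good_bad (A : E ≃ₗᵢ[ℂ] E) (e₀ : E) (he₀ : ‖e₀‖ = 1)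
    (G : Submodule ℂ E) {a : ℝ} (ha : a = ‖(G.orthogonalProjectionOnto (A e₀) : E)‖ ^ 2)
    (α β : ℝ) :
    ampQ A e₀ G (-1) (-1) ((α : ℂ) • (G.orthogonalProjectionOnto (A e₀) : E)
        + (β : ℂ) • (A e₀ - G.orthogonalProjectionOnto (A e₀))) =
      (((1 - 2 * a) * α + 2 * (1 - a) * β : ℝ) : ℂ) • (G.orthogonalProjectionOnto (A e₀) : E)
        + (((1 - 2 * a) * β - 2 * a * α : ℝ) : ℂ)
          • (A e₀ - G.orthogonalProjectionOnto (A e₀)) := by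
  have hpp : G.starProjection (G.starProjection (A e₀)) = G.starProjection (A e₀) :=
    Submodule.starProjection_eq_self_iff.2 (G.starProjection_apply_mem _)
  have hin : ⟪A e₀, G.starProjection (A e₀)⟫_ℂ = a := by
    rw [← hpp, ← Submodule.inner_starProjection_left_eq_right, inner_self_eq_norm_sq_to_K, ha,
      Submodule.starProjection_apply]
    norm_cast
  have hone : ⟪A e₀, A e₀⟫_ℂ = 1 := by
    rw [inner_self_eq_norm_sq_to_K, A.norm_map, he₀]
    simp
  rw [ampQ_neg_one_neg_one_apply A e₀ he₀]
  simp only [← Submodule.starProjection_apply] at *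
  simp only [map_add, map_sub, map_smul, hpp, sub_self, smul_zero, add_zero, inner_sub_right,
    inner_add_right, inner_smul_right, hin, hone]
  push_cast
  module

/-- The iterates of `Q` rotate by `2θ` in the plane spanned by the good and bad components. -/
theorem exists_ampQ_iterate_eq (A : E ≃ₗᵢ[ℂ] E) (e₀ : E) (he₀ : ‖e₀‖ = 1)
    (G : Submodule ℂ E) {θ : ℝ}
    (hθ : Real.sin θ ^ 2 = ‖(G.orthogonalProjectionOnto (A e₀) : E)‖ ^ 2) (k : ℕ) :
    ∃ α β : ℝ, α * Real.sin θ = Real.sin ((2 * k + 1) * θ) ∧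
      β * Real.cos θ = Real.cos ((2 * k + 1) * θ) ∧
      (ampQ A e₀ G (-1) (-1))^[k] (A e₀) =
        (α : ℂ) • (G.orthogonalProjectionOnto (A e₀) : E)
          + (β : ℂ) • (A e₀ - G.orthogonalProjectionOnto (A e₀)) := by
  induction k with
  | zero => exact ⟨1, 1, by simp, by simp, by simp⟩
  | succ k ih =>
    obtain ⟨α, β, hα, hβ, h⟩ := ih
    have hk : (2 * ((k + 1 : ℕ) : ℝ) + 1) * θ = (2 * k + 1) * θ + 2 * θ := by push_cast; ring
    refine ⟨_, _, ?_, ?_, by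
      rw [Function.iterate_succ_apply', h, ampQ_neg_one_neg_one_good_bad A e₀ he₀ G hθ]⟩
    · rw [hk, Real.sin_add, ← hα, ← hβ, Real.sin_two_mul, Real.cos_two_mul, Real.sin_sq]
      ring
    · rw [hk, Real.cos_add, ← hα, ← hβ, Real.sin_two_mul, Real.cos_two_mul, Real.sin_sq]
      linear_combination 2 * α * Real.cos θ * Real.sin_sq_add_cos_sq θ

/-- The probability of measuring a good state after `k` rounds of amplitude amplification. -/
theorem norm_sq_orthogonalProjectionOnto_ampQ_iterate (A : E ≃ₗᵢ[ℂ] E) (e₀ : E) (he₀ : ‖e₀‖ = 1)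
    (G : Submodule ℂ E) {θ : ℝ}
    (hθ : Real.sin θ ^ 2 = ‖(G.orthogonalProjectionOnto (A e₀) : E)‖ ^ 2) (k : ℕ) :
    ‖(G.orthogonalProjectionOnto ((ampQ A e₀ G (-1) (-1))^[k] (A e₀)) : E)‖ ^ 2 =
      Real.sin ((2 * k + 1) * θ) ^ 2 := by
  obtain ⟨α, β, hα, -, h⟩ := exists_ampQ_iterate_eq A e₀ he₀ G hθ k
  have hpp : G.starProjection (G.starProjection (A e₀)) = G.starProjection (A e₀) :=
    Submodule.starProjection_eq_self_iff.2 (G.starProjection_apply_mem _)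
  rw [h]
  simp only [← Submodule.starProjection_apply] at *
  simp only [map_add, map_sub, map_smul, hpp, sub_self, smul_zero, add_zero]
  rw [norm_smul, mul_pow, ← hθ, ← hα, mul_pow, Complex.norm_real, Real.norm_eq_abs, sq_abs]

end Reflections

theorem cos_sq_le_sin_sq_of_abs_sub_pi_div_two_le {x θ : ℝ} (h : |x - Real.pi / 2| ≤ θ)
    (hθ : θ ≤ Real.pi / 2) : Real.cos θ ^ 2 ≤ Real.sin x ^ 2 := by
  have hcos : Real.cos θ ≤ Real.sin x := by
    rw [← Real.cos_sub_pi_div_two, ← Real.cos_abs (x - Real.pi / 2)]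
    exact Real.cos_le_cos_of_nonneg_of_le_pi (abs_nonneg _) (by linarith [Real.pi_pos]) h
  have h0 := (abs_nonneg _).trans h
  have := Real.cos_nonneg_of_mem_Icc (x := θ) ⟨by linarith [Real.pi_pos], hθ⟩
  gcongr

/-- With `⌊π / (4θ)⌋` rounds the rotated angle ends up within `θ` of `π / 2`. -/
theorem abs_two_mul_floor_add_one_mul_sub_le {θ : ℝ} (hθ : 0 < θ) :
    |(2 * (⌊Real.pi / (4 * θ)⌋₊ : ℝ) + 1) * θ - Real.pi / 2| ≤ θ := by
  have hle := Nat.floor_le (a := Real.pi / (4 * θ)) (by positivity)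
  have hlt := Nat.lt_floor_add_one (Real.pi / (4 * θ))
  rw [le_div_iff₀ (by positivity)] at hle
  rw [div_lt_iff₀ (by positivity)] at hlt
  rw [abs_le]
  constructor <;> linarith

/-- Quadratic speedup: with `m = ⌊π/(4θ)⌋`, measuring `Q^m A|0⟩` yields a good state with
probability `sin²((2m+1)θ) ≥ max(1−a, a)`. -/
theorem stmt7 {E : Type*} [NormedAddCommGroup E] [InnerProductSpace ℂ E]
    [FiniteDimensional ℂ E]
    (A : E ≃ₗᵢ[ℂ] E) (e₀ : E) (he₀ : ‖e₀‖ = 1) (G : Submodule ℂ E)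
    (ψ ψa : E) (a θ : ℝ) (m : ℕ)
    (hψ : ψ = A e₀) (hψa : ψa = (Submodule.orthogonalProjectionOnto G ψ : E))
    (ha : a = ‖ψa‖ ^ 2) (ha0 : 0 < a) (ha1 : a ≤ 1)
    (hθ0 : 0 < θ) (hθ1 : θ ≤ Real.pi / 2) (hθa : Real.sin θ ^ 2 = a)
    (hm : m = ⌊Real.pi / (4 * θ)⌋₊) :
    ‖(Submodule.orthogonalProjectionOnto G ((ampQ A e₀ G (-1) (-1))^[m] ψ) : E)‖ ^ 2
        = Real.sin ((2 * m + 1) * θ) ^ 2 ∧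
    Real.sin ((2 * m + 1) * θ) ^ 2 ≥ max (1 - a) a := by
  subst hψ hψa
  refine ⟨norm_sq_orthogonalProjectionOnto_ampQ_iterate A e₀ he₀ G (hθa.trans ha) m, ?_⟩
  have hcos : 1 - a ≤ Real.sin ((2 * m + 1) * θ) ^ 2 := by
    rw [← hθa, ← Real.cos_sq', hm]
    exact cos_sq_le_sin_sq_of_abs_sub_pi_div_two_le (abs_two_mul_floor_add_one_mul_sub_le hθ0) hθ1
  refine max_le hcos ?_
  rcases le_or_gt θ (Real.pi / 4) with h | h
  · have hsc : Real.sin θ ^ 2 ≤ Real.cos θ ^ 2 := by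
      have := Real.cos_nonneg_of_mem_Icc (x := 2 * θ) ⟨by linarith [Real.pi_pos], by linarith⟩
      rw [Real.cos_two_mul'] at this
      linarith
    rw [Real.cos_sq'] at hsc
    linarith
  · have hm0 : m = 0 := by
      rw [hm, Nat.floor_eq_zero, div_lt_one (by positivity)]
      linarith
    simp [hm0, hθa]
end

section
/- (De-randomization, second method / Chi–Kim phases.) Let a, k, ℓ be real numbers with 0 < a < 1, a·k² + (1−a)·ℓ² = 1, k ≠ 0, and 0 < ℓ² ≤ 4a. Then there exist complex numbers φ and ϕ of unit norm such that ℓ² = 2a·(1 − Re φ) and ϕ·(1−φ)·a·k − ((1−φ)·a + φ)·ℓ = 0. Consequently, if ψ_a, ψ_b are the good and bad components of ψ = A e₀ with a = ‖ψ_a‖² and Q = Q(A,G,φ,ϕ), then Q(k·ψ_a + ℓ·ψ_b) lies in the good subspace G, i.e., one more iteration with these phase factors produces a good solution with certainty. -/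
open scoped InnerProductSpace

theorem exists_unit_phases {a k ℓ : ℝ} (ha0 : 0 < a)
    (hnorm : a * k ^ 2 + (1 - a) * ℓ ^ 2 = 1) (hk : k ≠ 0)
    (hℓ0 : 0 < ℓ ^ 2) (hℓ4a : ℓ ^ 2 ≤ 4 * a) :
    ∃ φ ϕ : ℂ, ‖φ‖ = 1 ∧ ‖ϕ‖ = 1 ∧ ℓ ^ 2 = 2 * a * (1 - φ.re) ∧
      ϕ * (1 - φ) * (a : ℂ) * (k : ℂ) - ((1 - φ) * (a : ℂ) + φ) * (ℓ : ℂ) = 0 := by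
  obtain ⟨c, hc⟩ : ∃ c : ℝ, ℓ ^ 2 = 2 * a * (1 - c) :=
    ⟨1 - ℓ ^ 2 / (2 * a), by field_simp; ring⟩
  have hc1 : c < 1 := by
    by_contra! h
    nlinarith
  have hc2 : -1 ≤ c := by
    by_contra! h
    nlinarith
  have hs : √(1 - c ^ 2) ^ 2 = 1 - c ^ 2 := Real.sq_sqrt (by nlinarith)
  set s := √(1 - c ^ 2)
  have hD : (1 - (⟨c, s⟩ : ℂ)) * (a : ℂ) * (k : ℂ) ≠ 0 := by
    refine mul_ne_zero (mul_ne_zero (fun h => ?_) (by exact_mod_cast ha0.ne'))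
      (by exact_mod_cast hk)
    have := congrArg Complex.re h
    simp at this
    linarith
  refine ⟨⟨c, s⟩, ((1 - ⟨c, s⟩) * (a : ℂ) + ⟨c, s⟩) * (ℓ : ℂ) /
    ((1 - ⟨c, s⟩) * (a : ℂ) * (k : ℂ)), ?_, ?_, hc, ?_⟩
  · rw [← sq_eq_sq₀ (norm_nonneg _) zero_le_one, Complex.sq_norm, Complex.normSq_mk]
    linarith
  · rw [norm_div, div_eq_one_iff_eq (norm_ne_zero_iff.mpr hD),
      ← sq_eq_sq₀ (norm_nonneg _) (norm_nonneg _), Complex.sq_norm, Complex.sq_norm]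
    have h1 : Complex.normSq (1 - (⟨c, s⟩ : ℂ)) = 2 * (1 - c) := by
      simp [Complex.normSq_apply]
      linear_combination hs
    have h2 : Complex.normSq ((1 - (⟨c, s⟩ : ℂ)) * (a : ℂ) + ⟨c, s⟩) = a * k ^ 2 := by
      simp [Complex.normSq_apply]
      linear_combination (1 - a) ^ 2 * hs + (1 - a) * hc - hnorm
    simp only [map_mul, h1, h2, Complex.normSq_ofReal]
    linear_combination a * k ^ 2 * hc
  · rw [mul_assoc, mul_assoc, ← mul_assoc (1 - _), div_mul_cancel₀ _ hD, sub_self]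

theorem apply_Sop_span_singleton_symm_apply {E : Type*} [NormedAddCommGroup E]
    [InnerProductSpace ℂ E] [FiniteDimensional ℂ E] (A : E ≃ₗᵢ[ℂ] E) {e : E} (he : ‖e‖ = 1)
    (φ : ℂ) (y : E) :
    A (Sop (ℂ ∙ e) φ (A.symm y)) = y - ((1 - φ) * ⟪A e, y⟫_ℂ) • A e := by
  have h : ⟪e, A.symm y⟫_ℂ = ⟪A e, y⟫_ℂ := by
    rw [← A.inner_map_map, A.apply_symm_apply]
  simp [Sop, Submodule.starProjection_unit_singleton ℂ he, h,
    smul_smul]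

/-- De-randomization, second method (Chi–Kim phases): there exist unit-norm phases `φ, ϕ` with
`ℓ² = 2a(1 − Re φ)` and `ϕ(1−φ)a·k − ((1−φ)a + φ)·ℓ = 0`, and with these phases one more
iteration of `Q` sends `k·ψ_a + ℓ·ψ_b` into the good subspace `G`. -/
theorem stmt9 {E : Type*} [NormedAddCommGroup E] [InnerProductSpace ℂ E]
    [FiniteDimensional ℂ E]
    (A : E ≃ₗᵢ[ℂ] E) (e₀ : E) (he₀ : ‖e₀‖ = 1) (G : Submodule ℂ E)
    (ψ ψa ψb : E) (a k ℓ : ℝ)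
    (hψ : ψ = A e₀) (hψa : ψa = (Submodule.orthogonalProjectionOnto G ψ : E)) (hψb : ψb = ψ - ψa)
    (ha : a = ‖ψa‖ ^ 2) (ha0 : 0 < a) (ha1 : a < 1)
    (hnorm : a * k ^ 2 + (1 - a) * ℓ ^ 2 = 1) (hk : k ≠ 0)
    (hℓ0 : 0 < ℓ ^ 2) (hℓ4a : ℓ ^ 2 ≤ 4 * a) :
    ∃ φ ϕ : ℂ, ‖φ‖ = 1 ∧ ‖ϕ‖ = 1 ∧
      ℓ ^ 2 = 2 * a * (1 - φ.re) ∧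
      ϕ * (1 - φ) * (a : ℂ) * (k : ℂ) - ((1 - φ) * (a : ℂ) + φ) * (ℓ : ℂ) = 0 ∧
      ampQ A e₀ G φ ϕ ((k : ℂ) • ψa + (ℓ : ℂ) • ψb) ∈ G := by
  obtain ⟨φ, ϕ, hφ, hϕ, h1, h2⟩ := exists_unit_phases ha0 hnorm hk hℓ0 hℓ4a
  refine ⟨φ, ϕ, hφ, hϕ, h1, h2, ?_⟩
  have hGa : ψa ∈ G := hψa ▸ Submodule.coe_mem _
  have hGb : ψb ∈ Gᗮ := by
    rw [hψb, hψa, ← Submodule.starProjection_apply]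
    exact Submodule.sub_starProjection_mem_orthogonal _
  have hS : Sop G ϕ ((k : ℂ) • ψa + (ℓ : ℂ) • ψb) = (k * ϕ : ℂ) • ψa + (ℓ : ℂ) • ψb := by
    rw [Sop, ← Submodule.starProjection_apply, map_add, map_smul, map_smul,
      Submodule.starProjection_eq_self_iff.mpr hGa,
      (Submodule.starProjection_apply_eq_zero_iff G).mpr hGb]
    module
  have hab : ψ = ψa + ψb := by rw [hψb]; abel
  have hψ1 : ‖ψ‖ = 1 := by rw [hψ, A.norm_map, he₀]
  have iab : ⟪ψa, ψb⟫_ℂ = 0 := hGb _ hGa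
  have iba : ⟪ψb, ψa⟫_ℂ = 0 := inner_eq_zero_symm.mp iab
  have iaa : ⟪ψa, ψa⟫_ℂ = a := by rw [inner_self_eq_norm_sq_to_K, ha]; norm_cast
  have ibb : ⟪ψb, ψb⟫_ℂ = 1 - a := by
    have h : ⟪ψ, ψ⟫_ℂ = 1 := by rw [inner_self_eq_norm_sq_to_K, hψ1]; norm_num
    rw [hab, inner_add_left, inner_add_right, inner_add_right, iab, iba, iaa] at h
    linear_combination h
  have hin : ⟪ψ, (k * ϕ : ℂ) • ψa + (ℓ : ℂ) • ψb⟫_ℂ = k * ϕ * a + ℓ * (1 - a) := by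
    rw [hab, inner_add_left, inner_add_right, inner_add_right]
    simp only [inner_smul_right, iab, iba, iaa, ibb]
    ring
  rw [ampQ, hS, apply_Sop_span_singleton_symm_apply A he₀, ← hψ, hin, hab]
  have key : -((k * ϕ : ℂ) • ψa + (ℓ : ℂ) • ψb -
      ((1 - φ) * (k * ϕ * a + ℓ * (1 - a))) • (ψa + ψb)) =
      ((1 - φ) * (k * ϕ * a + ℓ * (1 - a)) - k * ϕ) • ψa +
      (ϕ * (1 - φ) * (a : ℂ) * (k : ℂ) - ((1 - φ) * (a : ℂ) + φ) * (ℓ : ℂ)) • ψb := by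
    module
  rw [key, h2, zero_smul, add_zero]
  exact G.smul_mem _ hGa
end

section
/- Let P ≥ 2 be an integer and f an integer with 0 < f < P/2, and set θ = πf/P. Define v : {0,…,P−1} → ℂ by v_m = sin((2m+1)θ), and let w be its discrete Fourier transform, w_l = (1/√P)·∑_{m=0}^{P−1} e^{2πi·m·l/P}·v_m. Then ∑_{m=0}^{P−1} sin²((2m+1)θ) = P/2, w_l = 0 for every l ∉ {f, P−f}, and |w_f|² = |w_{P−f}|² = P/4. -/
open Finset

theorem sum_exp_two_pi_mul_I_of_dvd {P : ℕ} (hP : P ≠ 0) {k : ℤ} (hk : (P : ℤ) ∣ k) :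
    ∑ m ∈ range P, Complex.exp (2 * (Real.pi : ℂ) * Complex.I * m * k / P) = P := by
  obtain ⟨c, rfl⟩ := hk
  have hP' : (P : ℂ) ≠ 0 := by exact_mod_cast hP
  rw [Finset.sum_congr rfl (g := fun _ ↦ (1 : ℂ))]
  · simp
  · intro m _
    rw [Complex.exp_eq_one_iff]
    refine ⟨m * c, ?_⟩
    push_cast
    field_simp

theorem sum_exp_two_pi_mul_I_of_not_dvd {P : ℕ} {k : ℤ} (hk : ¬ (P : ℤ) ∣ k) :
    ∑ m ∈ range P, Complex.exp (2 * (Real.pi : ℂ) * Complex.I * m * k / P) = 0 := by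
  rcases eq_or_ne P 0 with rfl | hP
  · simp
  have hP' : (P : ℂ) ≠ 0 := by exact_mod_cast hP
  have hne : Complex.exp (2 * (Real.pi : ℂ) * Complex.I * k / P) ≠ 1 := by
    rw [Ne, Complex.exp_eq_one_iff]
    rintro ⟨n, hn⟩
    apply hk
    refine ⟨n, ?_⟩
    have h2 := Complex.two_pi_I_ne_zero
    rw [div_eq_iff hP'] at hn
    have : (k : ℂ) = P * n := by
      apply mul_left_cancel₀ h2
      rw [hn]
      ring
    exact_mod_cast this
  have hpow : Complex.exp (2 * (Real.pi : ℂ) * Complex.I * k / P) ^ P = 1 := by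
    rw [← Complex.exp_nat_mul, Complex.exp_eq_one_iff]
    exact ⟨k, by field_simp⟩
  have hgeom := geom_sum_eq hne P
  rw [hpow, sub_self, zero_div] at hgeom
  rw [← hgeom]
  refine Finset.sum_congr rfl fun m _ ↦ ?_
  rw [← Complex.exp_nat_mul]
  ring_nf

theorem sum_sin_sq_odd_mul {P f : ℕ} (h : ¬ (P : ℤ) ∣ 2 * f) :
    ∑ m ∈ range P, Real.sin ((2 * m + 1) * (Real.pi * f / P)) ^ 2 = P / 2 := by
  have hterm (m : ℕ) : Real.sin ((2 * m + 1) * (Real.pi * f / P)) ^ 2 = 1 / 2 -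
      (Complex.exp ((2 * (Real.pi * f / P) : ℝ) * Complex.I) *
        Complex.exp (2 * (Real.pi : ℂ) * Complex.I * m * (2 * f : ℤ) / P)).re / 2 := by
    rw [← Complex.exp_add, Real.sin_sq_eq_half_sub, ← Complex.exp_ofReal_mul_I_re]
    push_cast
    ring_nf
  simp_rw [hterm]
  rw [Finset.sum_sub_distrib, ← Finset.sum_div, ← Finset.sum_div, ← Complex.re_sum,
    ← Finset.mul_sum, sum_exp_two_pi_mul_I_of_not_dvd h]
  simp [div_eq_mul_inv]

theorem sum_exp_mul_sin_odd_mul (P f l : ℕ) :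
    ∑ m ∈ range P, Complex.exp (2 * (Real.pi : ℂ) * Complex.I * m * l / P) *
        (Real.sin ((2 * m + 1) * (Real.pi * f / P)) : ℂ) =
      (Complex.exp ((-(Real.pi * f / P) : ℝ) * Complex.I) *
          ∑ m ∈ range P, Complex.exp (2 * (Real.pi : ℂ) * Complex.I * m * (l - f : ℤ) / P) -
        Complex.exp ((Real.pi * f / P : ℝ) * Complex.I) *
          ∑ m ∈ range P, Complex.exp (2 * (Real.pi : ℂ) * Complex.I * m * (l + f : ℤ) / P)) *
      (Complex.I / 2) := by
  rw [Finset.mul_sum, Finset.mul_sum, ← Finset.sum_sub_distrib, Finset.sum_mul]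
  refine Finset.sum_congr rfl fun m _ ↦ ?_
  rw [Complex.ofReal_sin, Complex.sin, mul_div_assoc, mul_div_assoc', ← mul_assoc, mul_sub,
    ← Complex.exp_add, ← Complex.exp_add, ← Complex.exp_add, ← Complex.exp_add]
  push_cast
  ring_nf

/-- Integer-frequency case of quantum counting: for `θ = πf/P` with `f` an integer,
`0 < f < P/2`, the vector `v_m = sin((2m+1)θ)` has squared norm `P/2`, and its discrete
Fourier transform `w` is supported on `{f, P−f}` with `|w_f|² = |w_{P−f}|² = P/4`. -/
theorem stmt12 (P f : ℕ) (hP : 2 ≤ P) (hf0 : 0 < f) (hf : 2 * f < P)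
    (θ : ℝ) (hθ : θ = Real.pi * f / P)
    (v : ℕ → ℂ) (hv : ∀ m, v m = (Real.sin ((2 * m + 1) * θ) : ℂ))
    (w : ℕ → ℂ)
    (hw : ∀ l, w l = (1 / (Real.sqrt P : ℂ))
        * ∑ m ∈ range P, Complex.exp (2 * (Real.pi : ℂ) * Complex.I * m * l / P) * v m) :
    (∑ m ∈ range P, Real.sin ((2 * m + 1) * θ) ^ 2 = P / 2) ∧
    (∀ l < P, l ≠ f → l ≠ P - f → w l = 0) ∧
    ‖w f‖ ^ 2 = P / 4 ∧ ‖w (P - f)‖ ^ 2 = P / 4 := by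
  subst hθ
  have not_dvd {k : ℤ} (h1 : -P < k) (h2 : k < 2 * P) (h3 : k ≠ 0) (h4 : k ≠ P) :
      ¬ (P : ℤ) ∣ k := by
    rintro ⟨c, rfl⟩
    have hc1 : -1 < c := by nlinarith
    have hc2 : c < 2 := by nlinarith
    interval_cases c <;> simp at h3 h4
  have hP0 : P ≠ 0 := by omega
  have hPr : (P : ℝ) ≠ 0 := by exact_mod_cast hP0
  have hsq : Real.sqrt P ^ 2 = P := Real.sq_sqrt (Nat.cast_nonneg P)
  simp_rw [hv, sum_exp_mul_sin_odd_mul] at hw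
  refine ⟨sum_sin_sq_odd_mul (not_dvd (by omega) (by omega) (by omega) (by omega)), ?_, ?_, ?_⟩
  · intro l hl h1 h2
    rw [hw, sum_exp_two_pi_mul_I_of_not_dvd (not_dvd (by omega) (by omega) (by omega) (by omega)),
      sum_exp_two_pi_mul_I_of_not_dvd (not_dvd (by omega) (by omega) (by omega) (by omega))]
    simp
  · rw [hw, sum_exp_two_pi_mul_I_of_dvd hP0 (by simp),
      sum_exp_two_pi_mul_I_of_not_dvd (not_dvd (by omega) (by omega) (by omega) (by omega)),
      mul_zero, sub_zero, norm_mul, norm_mul, norm_mul, Complex.norm_exp_ofReal_mul_I]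
    simp [mul_pow, hsq]
    field_simp
    norm_num
  · rw [hw, sum_exp_two_pi_mul_I_of_not_dvd
        (not_dvd (by omega) (by omega) (by omega) (by omega)),
      sum_exp_two_pi_mul_I_of_dvd hP0 (by rw [Nat.cast_sub (by omega)]; simp),
      mul_zero, zero_sub, norm_mul, norm_mul, norm_neg, norm_mul, Complex.norm_exp_ofReal_mul_I]
    simp [mul_pow, hsq]
    field_simp
    norm_num
end

section
/- Let P ≥ 4 be an integer and θ ∈ (0, π/2) a real number such that f = Pθ/π satisfies 0 < f < P/2 and f is not an integer. Define v : {0,…,P−1} → ℂ by v_m = sin((2m+1)θ), and let w be the discrete Fourier transform w_l = (1/√P)·∑_{m=0}^{P−1} e^{2πi·m·l/P}·v_m. Let S ⊆ ℤ/Pℤ be the set of residues of ⌊f⌋, ⌈f⌉, P−⌊f⌋ and P−⌈f⌉ modulo P. Then the squared norm of w outside S is less than 2/5 of the total: ∑_{l ∉ S} |w_l|² < (2/5)·∑_{m=0}^{P−1} |v_m|². -/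
open Finset

lemma pi_sq_bounds : 9.8696 < Real.pi ^ 2 ∧ Real.pi ^ 2 < 9.8697 := by
  have h1 := Real.pi_gt_d6
  have h2 := Real.pi_lt_d6
  constructor <;> nlinarith

lemma cos_lower_bound {x : ℝ} (hx0 : 0 ≤ x) (hx : x ≤ 4) :
    1 - x ^ 2 / 2 + 5 / 128 * x ^ 4 - x ^ 6 / 1024 ≤ Real.cos x := by
  have h1 := Real.one_sub_sq_div_two_le_cos (x := x / 4)
  have h2 : Real.cos (x / 2) = 2 * Real.cos (x / 4) ^ 2 - 1 := by
    rw [← Real.cos_two_mul]; ring_nf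
  have h3 : Real.cos x = 2 * Real.cos (x / 2) ^ 2 - 1 := by
    rw [← Real.cos_two_mul]; ring_nf
  have h4 : 1 - x ^ 2 / 8 + x ^ 4 / 512 ≤ Real.cos (x / 2) := by
    have : (1 - (x / 4) ^ 2 / 2) ^ 2 ≤ Real.cos (x / 4) ^ 2 :=
      pow_le_pow_left₀ (by nlinarith) h1 2
    rw [h2]; nlinarith
  rcases le_total 0 (1 - x ^ 2 / 8 + x ^ 4 / 512) with h | h
  · have : (1 - x ^ 2 / 8 + x ^ 4 / 512) ^ 2 ≤ Real.cos (x / 2) ^ 2 :=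
      pow_le_pow_left₀ h h4 2
    rw [h3]; nlinarith [sq_nonneg (x ^ 4)]
  · have hc := Real.neg_one_le_cos x
    have hy : 8 ≤ x ^ 2 := by
      by_contra! hlt
      nlinarith [sq_nonneg (x ^ 2 - 8), sq_nonneg x]
    nlinarith [mul_nonneg (sub_nonneg.2 hy) (sq_nonneg (x ^ 2 - 16))]

lemma sin_sq_lower_center {t : ℝ} (h0 : 0 ≤ t) (h1 : t ≤ 1) :
    0.1013 - (t - 1 / 2) ^ 2 + 3.08 * (t - 1 / 2) ^ 4 - 3.05 * (t - 1 / 2) ^ 6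
      ≤ Real.sin (Real.pi * t) ^ 2 / Real.pi ^ 2 := by
  obtain ⟨p1, p2⟩ := pi_sq_bounds
  have hpi := Real.pi_pos
  have ha : |t - 1 / 2| ≤ 1 / 2 := abs_le.2 ⟨by linarith, by linarith⟩
  have hb := cos_lower_bound (x := 2 * Real.pi * |t - 1 / 2|) (by positivity)
    (by nlinarith [Real.pi_lt_four])
  have hc : Real.cos (2 * Real.pi * |t - 1 / 2|) = 2 * Real.sin (Real.pi * t) ^ 2 - 1 := by
    have : Real.cos (2 * Real.pi * |t - 1 / 2|) = Real.cos (2 * Real.pi * (t - 1 / 2)) := by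
      rcases abs_choice (t - 1 / 2) with h | h <;> rw [h]
      rw [mul_neg, Real.cos_neg]
    rw [this, show 2 * Real.pi * (t - 1 / 2) = 2 * (Real.pi * t) - Real.pi by ring,
      Real.cos_sub_pi, Real.cos_two_mul, Real.cos_sq']
    ring
  have hx (n : ℕ) : (2 * Real.pi * |t - 1 / 2|) ^ (2 * n)
      = 4 ^ n * (Real.pi ^ 2) ^ n * ((t - 1 / 2) ^ 2) ^ n := by
    rw [pow_mul, mul_pow, mul_pow, sq_abs, mul_pow, mul_pow]; norm_num
  have hx1 := hx 1
  have hx2 := hx 2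
  have hx3 := hx 3
  norm_num only at hx1 hx2 hx3
  rw [hc, hx1, hx2, hx3] at hb
  rw [le_div_iff₀ (by positivity), show (t - 1 / 2) ^ 4 = ((t - 1 / 2) ^ 2) ^ 2 by ring,
    show (t - 1 / 2) ^ 6 = ((t - 1 / 2) ^ 2) ^ 3 by ring]
  have he : 0 ≤ (t - 1 / 2) ^ 2 := sq_nonneg _
  generalize (t - 1 / 2) ^ 2 = e at *
  generalize Real.pi ^ 2 = p at *
  have hp : p * p ≤ 9.8697 * p := by nlinarith
  have h2 : 3.08 * p * e ^ 2 ≤ 0.3125 * p ^ 2 * e ^ 2 := by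
    gcongr ?_ * _
    nlinarith
  have h3 : 0.03125 * p ^ 3 * e ^ 3 ≤ 3.05 * p * e ^ 3 := by
    gcongr ?_ * _
    nlinarith
  nlinarith

lemma sin_sq_lower_end {t : ℝ} (h0 : 0 ≤ t) :
    t ^ 2 * (1 - 3.29 * t ^ 2) ≤ Real.sin (Real.pi * t) ^ 2 / Real.pi ^ 2 := by
  obtain ⟨p1, p2⟩ := pi_sq_bounds
  have hpi := Real.pi_pos
  rw [le_div_iff₀ (by positivity)]
  have hs := Real.sin_ge_sub_cube (x := Real.pi * t) (by positivity)
  rcases le_total (1 - 3.29 * t ^ 2) 0 with h | h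
  · have : t ^ 2 * (1 - 3.29 * t ^ 2) * Real.pi ^ 2 ≤ 0 :=
      mul_nonpos_of_nonpos_of_nonneg (mul_nonpos_of_nonneg_of_nonpos (sq_nonneg t) h)
        (by positivity)
    exact this.trans (sq_nonneg _)
  · have h6 : 0 ≤ Real.pi * t - (Real.pi * t) ^ 3 / 6 := by
      have : 0 ≤ (Real.pi * t) * (1 - Real.pi ^ 2 * t ^ 2 / 6) :=
        mul_nonneg (by positivity) (by nlinarith [sq_nonneg t])
      nlinarith
    have := pow_le_pow_left₀ h6 hs 2
    refine le_trans ?_ this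
    have hz : (Real.pi * t - (Real.pi * t) ^ 3 / 6) ^ 2 =
      Real.pi ^ 2 * t ^ 2 * (1 - Real.pi ^ 2 * t ^ 2 / 6) ^ 2 := by ring
    rw [hz]
    have : 1 - 3.29 * t ^ 2 ≤ (1 - Real.pi ^ 2 * t ^ 2 / 6) ^ 2 := by
      nlinarith [sq_nonneg t, sq_nonneg (Real.pi ^ 2 * t ^ 2 )]
    calc _ = Real.pi ^ 2 * t ^ 2 * (1 - 3.29 * t ^ 2) := by ring
      _ ≤ _ := by gcongr

lemma inv_sq_add_inv_sq {t : ℝ} (h0 : 0 < t) (h1 : t < 1) :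
    1 / t ^ 2 + 1 / (1 - t) ^ 2
      = 8 * (1 + 4 * (t - 1 / 2) ^ 2) / (1 - 4 * (t - 1 / 2) ^ 2) ^ 2 := by
  have h2 : 1 - t ≠ 0 := by linarith
  rw [show 1 - 4 * (t - 1 / 2) ^ 2 = 4 * t * (1 - t) by ring]
  field_simp
  ring

lemma two_terms_center {s t : ℝ} (h0 : 1 / 2 ≤ t) (h1 : t ≤ 3 / 4)
    (hs : 0.1013 - (t - 1 / 2) ^ 2 + 3.08 * (t - 1 / 2) ^ 4 - 3.05 * (t - 1 / 2) ^ 6 ≤ s) :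
    0.8103 + 1.65 * (t - 1 / 2) ^ 2 - 6 * (t - 1 / 2) ^ 4
      ≤ s * (1 / t ^ 2 + 1 / (1 - t) ^ 2) := by
  rw [inv_sq_add_inv_sq (by linarith) (by linarith)]
  rw [show (t - 1 / 2) ^ 4 = ((t - 1 / 2) ^ 2) ^ 2 by ring,
    show (t - 1 / 2) ^ 6 = ((t - 1 / 2) ^ 2) ^ 3 by ring] at *
  have he0 : 0 ≤ (t - 1 / 2) ^ 2 := sq_nonneg _
  have he1 : (t - 1 / 2) ^ 2 ≤ 1 / 16 := by nlinarith
  generalize (t - 1 / 2) ^ 2 = e at *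
  rw [← mul_div_assoc, le_div_iff₀ (by nlinarith)]
  refine le_trans ?_ (mul_le_mul_of_nonneg_right hs (by positivity))
  nlinarith [mul_nonneg he0 (sub_nonneg.2 he1), pow_nonneg he0 3,
    mul_nonneg he0 (mul_nonneg he0 (sub_nonneg.2 he1)),
    mul_nonneg he0 (mul_nonneg he0 (mul_nonneg he0 (sub_nonneg.2 he1)))]

lemma two_terms {s t : ℝ} (h0 : 0 < t) (h1 : t < 1)
    (hs : 0.1013 - (t - 1 / 2) ^ 2 + 3.08 * (t - 1 / 2) ^ 4 - 3.05 * (t - 1 / 2) ^ 6 ≤ s)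
    (hs0 : t ^ 2 * (1 - 3.29 * t ^ 2) ≤ s) (hs1 : (1 - t) ^ 2 * (1 - 3.29 * (1 - t) ^ 2) ≤ s) :
    4 / 5 < s * (1 / t ^ 2 + 1 / (1 - t) ^ 2) := by
  have key : ∀ x, 0 < x → x ≤ 1 / 5 → x ^ 2 * (1 - 3.29 * x ^ 2) ≤ s →
      4 / 5 < s * (1 / x ^ 2 + 1 / (1 - x) ^ 2) := by
    intro x hx0 hx1 hx
    have : 4 / 5 < s / x ^ 2 := by
      rw [lt_div_iff₀ (by positivity)]
      have : x ^ 2 ≤ 1 / 25 := by nlinarith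
      nlinarith [mul_pos hx0 hx0]
    have hs : 0 ≤ s := le_trans (mul_nonneg (sq_nonneg x) (by nlinarith)) hx
    have : 0 ≤ s / (1 - x) ^ 2 := by positivity
    calc 4 / 5 < s / x ^ 2 + s / (1 - x) ^ 2 := by linarith
      _ = _ := by ring
  rcases le_total t (1 / 5) with h | h
  · exact key t h0 h hs0
  rcases le_total (4 / 5) t with h' | h'
  · have := key (1 - t) (by linarith) (by linarith) hs1
    rwa [sub_sub_cancel, add_comm (1 / (1 - t) ^ 2)] at this
  rw [inv_sq_add_inv_sq (by linarith) (by linarith)]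
  rw [show (t - 1 / 2) ^ 4 = ((t - 1 / 2) ^ 2) ^ 2 by ring,
    show (t - 1 / 2) ^ 6 = ((t - 1 / 2) ^ 2) ^ 3 by ring] at *
  have he0 : 0 ≤ (t - 1 / 2) ^ 2 := sq_nonneg _
  have he1 : (t - 1 / 2) ^ 2 ≤ 9 / 100 := by nlinarith
  generalize (t - 1 / 2) ^ 2 = e at *
  rw [← mul_div_assoc, lt_div_iff₀ (by nlinarith)]
  refine lt_of_lt_of_le ?_ (mul_le_mul_of_nonneg_right hs (by positivity))
  nlinarith [mul_nonneg he0 (sub_nonneg.2 he1), pow_nonneg he0 3,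
    mul_nonneg he0 (mul_nonneg he0 (sub_nonneg.2 he1)),
    mul_nonneg he0 (mul_nonneg he0 (mul_nonneg he0 (sub_nonneg.2 he1)))]

lemma three_terms_right {s t : ℝ} (h0 : 1 / 2 ≤ t) (h1 : t ≤ 3 / 4)
    (hs : 0.1013 - (t - 1 / 2) ^ 2 + 3.08 * (t - 1 / 2) ^ 4 - 3.05 * (t - 1 / 2) ^ 6 ≤ s) :
    4 / 5 + 1 / (40 * (1 - t)) < s * (1 / t ^ 2 + 1 / (1 - t) ^ 2 + 1 / (2 - t) ^ 2) := by
  have h2 := two_terms_center h0 h1 hs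
  obtain ⟨e, rfl⟩ : ∃ e, t = 1 / 2 + e := ⟨t - 1 / 2, by ring⟩
  rw [add_sub_cancel_left] at *
  have he0 : 0 ≤ e := by linarith
  have he1 : e ≤ 1 / 4 := by linarith
  have he2 : e ^ 2 ≤ 1 / 16 := by nlinarith
  have h3 : 0.1013 - e ^ 2 ≤ s := by
    nlinarith [mul_nonneg (sq_nonneg (e ^ 2)) (sub_nonneg.2 he2), sq_nonneg (e ^ 2)]
  have h4 : 4 / 9 + 0.592 * e ≤ 1 / (2 - (1 / 2 + e)) ^ 2 := by
    rw [le_div_iff₀ (by nlinarith)]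
    nlinarith [mul_nonneg he0 (sub_nonneg.2 he1), mul_nonneg he0 he0,
      mul_nonneg he0 (mul_nonneg he0 he0)]
  have h5 := mul_le_mul h3 h4 (by linarith) (by linarith)
  have h6 : 1 / (40 * (1 - (1 / 2 + e))) < 0.0103 + 1.65 * e ^ 2 - 6 * e ^ 4
      + (0.1013 - e ^ 2) * (4 / 9 + 0.592 * e) := by
    rw [div_lt_iff₀ (by linarith)]
    nlinarith [mul_nonneg he0 (sub_nonneg.2 he1),
      mul_nonneg he0 (mul_nonneg he0 (sub_nonneg.2 he1)),
      mul_nonneg he0 (mul_nonneg he0 (mul_nonneg he0 (sub_nonneg.2 he1))),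
      mul_nonneg he0 (mul_nonneg he0 (mul_nonneg he0 (mul_nonneg he0 (sub_nonneg.2 he1)))),
      mul_nonneg he0 (sq_nonneg (e - 0.1)), sq_nonneg (e - 0.05), pow_nonneg he0 3]
  linarith

lemma three_terms_left {s t : ℝ} (h0 : 1 / 2 ≤ t) (h1 : t ≤ 3 / 4)
    (hs : 0.1013 - (t - 1 / 2) ^ 2 + 3.08 * (t - 1 / 2) ^ 4 - 3.05 * (t - 1 / 2) ^ 6 ≤ s) :
    4 / 5 + 1 / (40 * t) < s * (1 / t ^ 2 + 1 / (1 - t) ^ 2 + 1 / (1 + t) ^ 2) := by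
  have h2 := two_terms_center h0 h1 hs
  obtain ⟨e, rfl⟩ : ∃ e, t = 1 / 2 + e := ⟨t - 1 / 2, by ring⟩
  rw [add_sub_cancel_left] at *
  have he0 : 0 ≤ e := by linarith
  have he1 : e ≤ 1 / 4 := by linarith
  have he2 : e ^ 2 ≤ 1 / 16 := by nlinarith
  have h3 : 0.1013 - e ^ 2 ≤ s := by
    nlinarith [mul_nonneg (sq_nonneg (e ^ 2)) (sub_nonneg.2 he2), sq_nonneg (e ^ 2)]
  have h4 : 4 / 9 - 0.593 * e ≤ 1 / (1 + (1 / 2 + e)) ^ 2 := by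
    rw [le_div_iff₀ (by nlinarith)]
    nlinarith [mul_nonneg he0 (sub_nonneg.2 he1), mul_nonneg he0 he0,
      mul_nonneg he0 (mul_nonneg he0 he0)]
  have h5 := mul_le_mul h3 h4 (by linarith) (by linarith)
  have h6 : 1 / (40 * (1 / 2 + e)) < 0.0103 + 1.65 * e ^ 2 - 6 * e ^ 4
      + (0.1013 - e ^ 2) * (4 / 9 - 0.593 * e) := by
    rw [div_lt_iff₀ (by linarith)]
    nlinarith [mul_nonneg he0 (sub_nonneg.2 he1),
      mul_nonneg he0 (mul_nonneg he0 (sub_nonneg.2 he1)),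
      mul_nonneg he0 (mul_nonneg he0 (mul_nonneg he0 (sub_nonneg.2 he1))),
      mul_nonneg he0 (mul_nonneg he0 (mul_nonneg he0 (mul_nonneg he0 (sub_nonneg.2 he1)))),
      mul_nonneg he0 (sq_nonneg (e - 0.1)), sq_nonneg (e - 0.05), pow_nonneg he0 3]
  linarith

lemma two_terms_right {s t : ℝ} (h0 : 1 / 2 ≤ t) (h1 : t ≤ 3 / 4)
    (hs : 0.1013 - (t - 1 / 2) ^ 2 + 3.08 * (t - 1 / 2) ^ 4 - 3.05 * (t - 1 / 2) ^ 6 ≤ s) :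
    4 / 5 + 12.5664 * (t - 1 / 2) / (40 * (2 - t)) < s * (1 / t ^ 2 + 1 / (1 - t) ^ 2) := by
  have h2 := two_terms_center h0 h1 hs
  refine lt_of_lt_of_le ?_ h2
  obtain ⟨e, rfl⟩ : ∃ e, t = 1 / 2 + e := ⟨t - 1 / 2, by ring⟩
  rw [add_sub_cancel_left, ← lt_sub_iff_add_lt', div_lt_iff₀ (by linarith)]
  have he0 : 0 ≤ e := by linarith
  have he1 : e ≤ 1 / 4 := by linarith
  nlinarith [mul_nonneg he0 (sub_nonneg.2 he1), sq_nonneg (e - 0.08),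
    mul_nonneg he0 (sq_nonneg (e - 0.08)),
    mul_nonneg he0 (mul_nonneg he0 (mul_nonneg he0 (sub_nonneg.2 he1)))]

lemma two_terms_left {s t y : ℝ} (h0 : 0 < t) (h1 : t ≤ 1 / 4)
    (hs0 : t ^ 2 * (1 - 3.29 * t ^ 2) ≤ s) (hy : y ≤ 12.5664 * (1 / 4 - t)) :
    4 / 5 + y / (40 * (1 / 2 - t)) < s * (1 / t ^ 2 + 1 / (1 - t) ^ 2) := by
  have ht : t ^ 2 ≤ 1 / 16 := by nlinarith
  have hs : 0 ≤ s := le_trans (mul_nonneg (sq_nonneg t) (by nlinarith)) hs0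
  have h2 : 1 - 3.29 * t ^ 2 ≤ s / t ^ 2 := by
    rw [le_div_iff₀ (by positivity)]
    linarith
  have h3 : s ≤ s / (1 - t) ^ 2 := le_div_self hs (by nlinarith) (by nlinarith)
  have h4 : 0.79 * t ^ 2 ≤ s := by nlinarith [sq_nonneg t]
  have h5 : y / (40 * (1 / 2 - t)) < 0.2 - 2.5 * t ^ 2 := by
    rw [div_lt_iff₀ (by linarith)]
    rcases le_total t (1 / 5) with h | h
    · nlinarith [mul_nonneg h0.le (sub_nonneg.2 h)]
    · nlinarith [mul_nonneg (sub_nonneg.2 h) (sub_nonneg.2 h1)]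
  calc _ < s / t ^ 2 + s / (1 - t) ^ 2 := by linarith
    _ = _ := by ring

lemma three_terms_near_zero {s t : ℝ} (h0 : 0 < t) (h1 : t ≤ 1 / 4)
    (hs0 : t ^ 2 * (1 - 3.29 * t ^ 2) ≤ s) :
    4 / 5 + 1 / 5 * ((1 - 8 * t ^ 2) * (1 - 2 * t ^ 2))
      < s * (1 / t ^ 2 + 1 / (1 - t) ^ 2 + 1 / (1 + t) ^ 2) := by
  have ht : t ^ 2 ≤ 1 / 16 := by nlinarith
  have hs : 0 ≤ s := le_trans (mul_nonneg (sq_nonneg t) (by nlinarith)) hs0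
  have h2 : 1 - 3.29 * t ^ 2 ≤ s / t ^ 2 := by
    rw [le_div_iff₀ (by positivity)]
    linarith
  have h3 : 2 ≤ 1 / (1 - t) ^ 2 + 1 / (1 + t) ^ 2 := by
    have : 0 < 1 - t := by linarith
    rw [div_add_div _ _ (by positivity) (by positivity), le_div_iff₀ (by positivity)]
    nlinarith
  have h4 := mul_le_mul_of_nonneg_left h3 hs
  have hp : 0 < t ^ 2 := by positivity
  calc _ < s / t ^ 2 + s * (1 / (1 - t) ^ 2 + 1 / (1 + t) ^ 2) := by nlinarith
    _ = _ := by ring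

/-- The squared norm of `∑_{m < P} e^{2πimx/P}`. -/
noncomputable def dirichletSq (P : ℕ) (x : ℝ) : ℝ :=
  ‖∑ m ∈ range P, Complex.exp (2 * Real.pi * Complex.I * m * x / P)‖ ^ 2

lemma dirichletSq_neg (P : ℕ) (x : ℝ) : dirichletSq P (-x) = dirichletSq P x := by
  unfold dirichletSq
  rw [← RCLike.norm_conj (K := ℂ), map_sum]
  congr 2
  refine sum_congr rfl fun m _ ↦ ?_
  rw [← Complex.exp_conj]
  congr 1
  simp [map_ofNat]

lemma dirichletSq_add_natCast (P : ℕ) (x : ℝ) :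
    dirichletSq P (x + P) = dirichletSq P x := by
  rcases Nat.eq_zero_or_pos P with rfl | hP
  · simp [dirichletSq]
  unfold dirichletSq
  congr 2
  refine sum_congr rfl fun m _ ↦ ?_
  have : (P : ℂ) ≠ 0 := by exact_mod_cast hP.ne'
  rw [show 2 * Real.pi * Complex.I * m * ((x + P : ℝ) : ℂ) / P
    = 2 * Real.pi * Complex.I * m * x / P + m * (2 * Real.pi * Complex.I) by
      push_cast; field_simp, Complex.exp_add, Complex.exp_nat_mul_two_pi_mul_I, mul_one]

lemma dirichletSq_mul_sin_sq (P : ℕ) (x : ℝ) (hP : 0 < P) :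
    dirichletSq P x * Real.sin (Real.pi * x / P) ^ 2 = Real.sin (Real.pi * x) ^ 2 := by
  have hP' : (P : ℂ) ≠ 0 := by exact_mod_cast hP.ne'
  have hg := geom_sum_mul (Complex.exp (Complex.I * (2 * Real.pi * x / P : ℝ))) P
  have hn := congrArg (fun z : ℂ ↦ ‖z‖ ^ 2) hg
  have h1 : Complex.exp (Complex.I * (2 * Real.pi * x / P : ℝ)) ^ P
      = Complex.exp (Complex.I * (2 * Real.pi * x : ℝ)) := by
    rw [← Complex.exp_nat_mul]
    congr 1
    push_cast
    field_simp
  have h2 : ∑ i ∈ range P, Complex.exp (Complex.I * (2 * Real.pi * x / P : ℝ)) ^ i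
      = ∑ m ∈ range P, Complex.exp (2 * Real.pi * Complex.I * m * x / P) := by
    refine sum_congr rfl fun m _ ↦ ?_
    rw [← Complex.exp_nat_mul]
    congr 1
    push_cast
    ring
  simp only [h1, h2, norm_mul, mul_pow, Complex.norm_exp_I_mul_ofReal_sub_one, Real.norm_eq_abs,
    sq_abs] at hn
  rw [show 2 * Real.pi * x / P / 2 = Real.pi * x / P by ring,
    show 2 * Real.pi * x / 2 = Real.pi * x by ring] at hn
  unfold dirichletSq
  linarith

lemma le_dirichletSq (P : ℕ) {x : ℝ} (hP : 0 < P) (hx : x ≠ 0) :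
    (P : ℝ) ^ 2 * (Real.sin (Real.pi * x) ^ 2 / Real.pi ^ 2 * (1 / x ^ 2)) ≤ dirichletSq P x := by
  have h := dirichletSq_mul_sin_sq P x hP
  have h0 : 0 ≤ dirichletSq P x := sq_nonneg _
  have h1 := mul_le_mul_of_nonneg_left (Real.sin_sq_le_sq (x := Real.pi * x / P)) h0
  rw [h] at h1
  have hP' : (0 : ℝ) < P := by exact_mod_cast hP
  have hpi := Real.pi_pos
  calc _ ≤ (P : ℝ) ^ 2 * (dirichletSq P x * (Real.pi * x / P) ^ 2 / Real.pi ^ 2 * (1 / x ^ 2)) := by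
        gcongr
    _ = _ := by field_simp

lemma sum_exp_eq_ite (P : ℕ) (hP : 0 < P) {m n : ℕ} (hm : m < P) (hn : n < P) :
    ∑ l ∈ range P, Complex.exp (2 * Real.pi * Complex.I * (m - n) * l / P)
      = if m = n then (P : ℂ) else 0 := by
  have hP' : (P : ℂ) ≠ 0 := by exact_mod_cast hP.ne'
  split_ifs with h
  · subst h; simp
  have h2 : ∑ l ∈ range P, Complex.exp (2 * Real.pi * Complex.I * (m - n) * l / P)
      = ∑ l ∈ range P, Complex.exp (2 * Real.pi * Complex.I * (m - n) / P) ^ l := by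
    refine sum_congr rfl fun l _ ↦ ?_
    rw [← Complex.exp_nat_mul]
    congr 1
    ring
  rw [h2]
  have hne : Complex.exp (2 * Real.pi * Complex.I * (m - n) / P) - 1 ≠ 0 := by
    rw [sub_ne_zero, Ne, Complex.exp_eq_one_iff]
    rintro ⟨k, hk⟩
    have : ((m : ℤ) - n) = k * P := by
      have hc : ((m : ℂ) - n) = k * P := by
        have := Complex.two_pi_I_ne_zero
        field_simp at hk
        linear_combination hk
      exact_mod_cast hc
    have hd : (P : ℤ) ∣ (m : ℤ) - n := ⟨k, by rw [this]; ring⟩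
    have := Int.eq_zero_of_abs_lt_dvd hd (by rw [abs_lt]; constructor <;> omega)
    omega
  have h1 : Complex.exp (2 * Real.pi * Complex.I * (m - n) / P) ^ P = 1 := by
    rw [← Complex.exp_nat_mul, Complex.exp_eq_one_iff]
    exact ⟨m - n, by push_cast; field_simp⟩
  have := geom_sum_mul (Complex.exp (2 * Real.pi * Complex.I * (m - n) / P)) P
  rw [h1, sub_self] at this
  exact (mul_eq_zero.1 this).resolve_right hne

lemma sum_dirichletSq (P : ℕ) (hP : 0 < P) (f : ℝ) :
    ∑ l ∈ range P, dirichletSq P (l - f) = (P : ℝ) ^ 2 := by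
  apply Complex.ofReal_injective
  have hD (l : ℕ) : ((dirichletSq P (l - f) : ℝ) : ℂ)
      = ∑ m ∈ range P, ∑ n ∈ range P,
          Complex.exp (-(2 * Real.pi * Complex.I * (m - n) * f / P))
            * Complex.exp (2 * Real.pi * Complex.I * (m - n) * l / P) := by
    unfold dirichletSq
    rw [Complex.ofReal_pow, ← Complex.mul_conj', map_sum, sum_mul_sum]
    refine sum_congr rfl fun m _ ↦ sum_congr rfl fun n _ ↦ ?_
    rw [← Complex.exp_conj, ← Complex.exp_add, ← Complex.exp_add]
    congr 1
    simp [map_ofNat]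
    ring
  rw [Complex.ofReal_sum, sum_congr rfl fun l _ ↦ hD l, sum_comm]
  have (m : ℕ) (hm : m ∈ range P) : ∑ l ∈ range P, ∑ n ∈ range P,
      Complex.exp (-(2 * Real.pi * Complex.I * (m - n) * f / P))
            * Complex.exp (2 * Real.pi * Complex.I * (m - n) * l / P) = P := by
    rw [sum_comm, sum_congr rfl (g := fun n ↦ if m = n then (P : ℂ) else 0), sum_ite_eq, if_pos hm]
    intro n hn
    rw [← mul_sum, sum_exp_eq_ite P hP (mem_range.1 hm) (mem_range.1 hn)]
    split_ifs with h
    · subst h; simp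
    · simp
  rw [sum_congr rfl this]
  simp [sq]

lemma norm_sub_sq_le (a b : ℂ) : ‖a - b‖ ^ 2 ≤ 2 * (‖a‖ ^ 2 + ‖b‖ ^ 2) := by
  have h := norm_sub_le a b
  have := pow_le_pow_left₀ (norm_nonneg _) h 2
  nlinarith [sq_nonneg (‖a‖ - ‖b‖)]

lemma norm_sq_transform_le (P : ℕ) (hP : 0 < P) (θ f : ℝ) (hf : f = P * θ / Real.pi) (l : ℕ) :
    ‖(1 / (Real.sqrt P : ℂ)) * ∑ m ∈ range P,
        Complex.exp (2 * (Real.pi : ℂ) * Complex.I * m * l / P)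
          * (Real.sin ((2 * m + 1) * θ) : ℂ)‖ ^ 2
      ≤ 1 / (2 * P) * (dirichletSq P (l - f) + dirichletSq P (l + f)) := by
  have hP' : (P : ℂ) ≠ 0 := by exact_mod_cast hP.ne'
  have hpi : (Real.pi : ℂ) ≠ 0 := by exact_mod_cast Real.pi_ne_zero
  have hsum : ∑ m ∈ range P, Complex.exp (2 * (Real.pi : ℂ) * Complex.I * m * l / P)
          * (Real.sin ((2 * m + 1) * θ) : ℂ)
      = (Complex.I / 2) * (Complex.exp ((-θ : ℝ) * Complex.I)
          * ∑ m ∈ range P, Complex.exp (2 * Real.pi * Complex.I * m * (l - f : ℝ) / P)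
        - Complex.exp (θ * Complex.I)
          * ∑ m ∈ range P, Complex.exp (2 * Real.pi * Complex.I * m * (l + f : ℝ) / P)) := by
    rw [mul_sum, mul_sum, ← sum_sub_distrib, mul_sum]
    refine sum_congr rfl fun m _ ↦ ?_
    have hf' : (f : ℂ) * Real.pi = P * θ := by
      exact_mod_cast show f * Real.pi = P * θ by rw [hf]; field_simp
    have h1 : Complex.exp ((-θ : ℝ) * Complex.I)
          * Complex.exp (2 * Real.pi * Complex.I * m * (l - f : ℝ) / P)
        = Complex.exp (2 * Real.pi * Complex.I * m * l / P)
          * Complex.exp (-((2 * m + 1) * θ : ℝ) * Complex.I) := by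
      rw [← Complex.exp_add, ← Complex.exp_add]
      congr 1
      push_cast
      field_simp
      linear_combination -2 * m * hf'
    have h2 : Complex.exp (θ * Complex.I)
          * Complex.exp (2 * Real.pi * Complex.I * m * (l + f : ℝ) / P)
        = Complex.exp (2 * Real.pi * Complex.I * m * l / P)
          * Complex.exp (((2 * m + 1) * θ : ℝ) * Complex.I) := by
      rw [← Complex.exp_add, ← Complex.exp_add]
      congr 1
      push_cast
      field_simp
      linear_combination 2 * m * hf'
    rw [h1, h2, Complex.ofReal_sin, Complex.sin]
    ring
  rw [hsum, norm_mul, norm_mul, mul_pow, mul_pow]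
  have h := norm_sub_sq_le (Complex.exp ((-θ : ℝ) * Complex.I)
          * ∑ m ∈ range P, Complex.exp (2 * Real.pi * Complex.I * m * (l - f : ℝ) / P))
      (Complex.exp (θ * Complex.I)
          * ∑ m ∈ range P, Complex.exp (2 * Real.pi * Complex.I * m * (l + f : ℝ) / P))
  rw [norm_mul, norm_mul, Complex.norm_exp_ofReal_mul_I, Complex.norm_exp_ofReal_mul_I, one_mul,
    one_mul] at h
  change _ ≤ 2 * (dirichletSq P (l - f) + dirichletSq P (l + f)) at h
  have hs : ‖(1 / (Real.sqrt P : ℂ))‖ ^ 2 = 1 / P := by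
    rw [norm_div, norm_one, Complex.norm_real, Real.norm_eq_abs, div_pow, sq_abs,
      Real.sq_sqrt (Nat.cast_nonneg _), one_pow]
  have hI : ‖Complex.I / 2‖ ^ 2 = 1 / 4 := by
    rw [norm_div, Complex.norm_I]; norm_num
  rw [hs, hI]
  calc _ ≤ 1 / (P : ℝ) * (1 / 4 * (2 * (dirichletSq P (l - f) + dirichletSq P (l + f)))) := by
        gcongr
    _ = _ := by ring

lemma sum_sin_sq (n : ℕ) (θ : ℝ) :
    4 * Real.sin (2 * θ) * ∑ m ∈ range n, Real.sin ((2 * m + 1) * θ) ^ 2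
      = 2 * n * Real.sin (2 * θ) - Real.sin (4 * n * θ) := by
  induction n with
  | zero => simp
  | succ n ih =>
    rw [sum_range_succ, mul_add, ih]
    have h1 : Real.sin ((2 * n + 1) * θ) ^ 2 = 1 / 2 - Real.cos ((4 * n + 2) * θ) / 2 := by
      rw [Real.sin_sq_eq_half_sub]; ring_nf
    have h2 : Real.sin (4 * (n + 1) * θ) - Real.sin (4 * n * θ)
        = 2 * Real.sin (2 * θ) * Real.cos ((4 * n + 2) * θ) := by
      rw [Real.sin_sub_sin]; ring_nf
    rw [h1]
    push_cast
    linear_combination h2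

lemma four_mul_le_mul_sin {P f c θ : ℝ} (hP : 0 < P) (hf : f = P * θ / Real.pi) (hc : 0 ≤ c)
    (h1 : c ≤ f) (h2 : c ≤ P / 2 - f) : 4 * c ≤ P * Real.sin (2 * θ) := by
  have hpi := Real.pi_pos
  have hθ : θ = f * Real.pi / P := by rw [hf]; field_simp
  have key : 2 / Real.pi * (2 * (c * Real.pi / P)) ≤ Real.sin (2 * θ) := by
    have hle : ∀ d, c ≤ d → d ≤ P / 4 →
        2 / Real.pi * (2 * (c * Real.pi / P)) ≤ Real.sin (2 * (d * Real.pi / P)) := by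
      intro d hd hd'
      have : d * Real.pi / P ≤ Real.pi / 4 := by
        rw [div_le_iff₀ hP]; nlinarith
      refine le_trans ?_ (Real.mul_le_sin (x := 2 * (d * Real.pi / P)) ?_ (by linarith))
      · gcongr
      · have : 0 ≤ d := by linarith
        positivity
    rcases le_total f (P / 4) with h | h
    · rw [hθ]; exact hle f h1 h
    · have := hle (P / 2 - f) h2 (by linarith)
      rwa [show 2 * ((P / 2 - f) * Real.pi / P) = Real.pi - 2 * θ by
        rw [hθ]; field_simp, Real.sin_pi_sub] at this
  have h := mul_le_mul_of_nonneg_left key hP.le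
  calc _ = P * (2 / Real.pi * (2 * (c * Real.pi / P))) := by field_simp; ring
    _ ≤ _ := h

lemma four_mul_sin_le_mul_sin {P f : ℝ} (hP : 4 ≤ P) (h0 : 0 ≤ f) (h1 : f ≤ 2) :
    4 * Real.sin (Real.pi * f / 2) ≤ P * Real.sin (2 * (Real.pi * f / P)) := by
  have hpi := Real.pi_pos
  have hP0 : 0 < P := by linarith
  have hc := strictConcaveOn_sin_Icc.concaveOn.2
    (show Real.pi * f / 2 ∈ Set.Icc 0 Real.pi from ⟨by positivity, by nlinarith⟩)
    (show (0 : ℝ) ∈ Set.Icc 0 Real.pi from ⟨le_rfl, hpi.le⟩) (show 0 ≤ 4 / P by positivity)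
      (sub_nonneg.2 ((div_le_one hP0).2 hP)) (by ring)
  simp only [smul_eq_mul, Real.sin_zero, mul_zero, add_zero] at hc
  rw [show 4 / P * (Real.pi * f / 2) = 2 * (Real.pi * f / P) by ring] at hc
  have := mul_le_mul_of_nonneg_left hc hP0.le
  calc _ = P * (4 / P * Real.sin (Real.pi * f / 2)) := by field_simp
    _ ≤ _ := this

lemma sin_four_pi_mul_le {t : ℝ} (h0 : 0 ≤ t) (h1 : t ≤ 1 / 4) :
    Real.sin (4 * Real.pi * t)
      ≤ 8 * Real.sin (Real.pi * t / 2) * ((1 - 8 * t ^ 2) * (1 - 2 * t ^ 2)) := by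
  have hpi := Real.pi_pos
  have hs : 0 ≤ Real.sin (Real.pi * t / 2) :=
    Real.sin_nonneg_of_nonneg_of_le_pi (by positivity) (by nlinarith)
  have hcos : ∀ k, 0 ≤ k → k ≤ 2 → Real.cos (k * Real.pi * t) ≤ 1 - 2 * (k * t) ^ 2 := by
    intro k hk hk'
    have h := Real.cos_le_one_sub_mul_cos_sq (x := k * Real.pi * t)
      (by rw [abs_of_nonneg (by positivity)]; nlinarith [mul_le_mul hk' h1 h0 (by norm_num)])
    calc _ ≤ _ := h
      _ = _ := by field_simp
  have h2 := hcos 2 (by norm_num) le_rfl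
  have h3 := hcos 1 (by norm_num) (by norm_num)
  have hc1 : 0 ≤ Real.cos (1 * Real.pi * t) :=
    Real.cos_nonneg_of_neg_pi_div_two_le_of_le (by nlinarith) (by nlinarith)
  have hc2 : 0 ≤ Real.cos (2 * Real.pi * t) :=
    Real.cos_nonneg_of_neg_pi_div_two_le_of_le (by nlinarith) (by nlinarith)
  have h4 := Real.cos_le_one (Real.pi * t / 2)
  have h5 := mul_le_mul h2 h3 hc1 (hc2.trans h2)
  have h6 : Real.sin (4 * Real.pi * t) = 8 * Real.sin (Real.pi * t / 2)
      * (Real.cos (2 * Real.pi * t) * Real.cos (1 * Real.pi * t)) * Real.cos (Real.pi * t / 2) := by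
    rw [show 4 * Real.pi * t = 2 * (2 * Real.pi * t) by ring, Real.sin_two_mul,
      show 2 * Real.pi * t = 2 * (1 * Real.pi * t) by ring, Real.sin_two_mul,
      show 1 * Real.pi * t = 2 * (Real.pi * t / 2) by ring, Real.sin_two_mul]
    ring
  rw [h6]
  calc _ ≤ 8 * Real.sin (Real.pi * t / 2)
      * (Real.cos (2 * Real.pi * t) * Real.cos (1 * Real.pi * t)) * 1 := by gcongr
    _ ≤ 8 * Real.sin (Real.pi * t / 2) * ((1 - 2 * (2 * t) ^ 2) * (1 - 2 * (1 * t) ^ 2)) := by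
        rw [mul_one]; gcongr
    _ = _ := by ring

lemma mem_of_sin_four_pi_mul_pos {t : ℝ} (h0 : 0 < t) (h1 : t < 1)
    (h : 0 < Real.sin (4 * Real.pi * t)) : t ≤ 1 / 4 ∨ 1 / 2 ≤ t ∧ t ≤ 3 / 4 := by
  have hpi := Real.pi_pos
  by_contra! hc
  obtain ⟨hc1, hc2⟩ := hc
  rcases lt_or_ge t (1 / 2) with h2 | h2
  · have := Real.sin_nonneg_of_nonneg_of_le_pi (x := 4 * Real.pi * t - Real.pi)
      (by nlinarith) (by nlinarith)
    rw [Real.sin_sub_pi] at this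
    linarith
  · have := Real.sin_nonneg_of_nonneg_of_le_pi (x := 4 * Real.pi * t - Real.pi - 2 * Real.pi)
      (by nlinarith [hc2 h2]) (by nlinarith)
    rw [Real.sin_sub_two_pi, Real.sin_sub_pi] at this
    linarith

/-- Reflecting the frequencies in a symmetric set does not change a sum over its complement. -/
lemma sum_sdiff_reflect (P : ℕ) (hP : 0 < P) (S : Finset ℕ)
    (hS : ∀ a ∈ S, (P - a) % P ∈ S) (g : ℕ → ℝ) :
    ∑ l ∈ range P \ S, g ((P - l) % P) = ∑ l ∈ range P \ S, g l := by
  have hinv : ∀ a ∈ range P, (P - (P - a) % P) % P = a := by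
    intro a ha
    rw [mem_range] at ha
    rcases Nat.eq_zero_or_pos a with rfl | h0
    · simp
    · rw [Nat.mod_eq_of_lt (show P - a < P by omega), Nat.mod_eq_of_lt (by omega)]
      omega
  have hmem : ∀ a ∈ range P \ S, (P - a) % P ∈ range P \ S := by
    intro a ha
    rw [mem_sdiff] at ha ⊢
    refine ⟨mem_range.2 (Nat.mod_lt _ hP), fun h ↦ ha.2 ?_⟩
    rw [← hinv a ha.1]
    exact hS _ h
  exact sum_nbij' (fun l ↦ (P - l) % P) (fun l ↦ (P - l) % P) hmem hmem
    (fun a ha ↦ hinv a (mem_sdiff.1 ha).1) (fun a ha ↦ hinv a (mem_sdiff.1 ha).1) (fun _ _ ↦ rfl)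

lemma dirichletSq_reflect (P : ℕ) {l : ℕ} (hl : l < P) (f : ℝ) :
    dirichletSq P (((P - l) % P : ℕ) - f) = dirichletSq P (l + f) := by
  rw [← dirichletSq_neg P (l + f)]
  rcases Nat.eq_zero_or_pos l with rfl | h0
  · simp
  · rw [Nat.mod_eq_of_lt (by omega), Nat.cast_sub hl.le, ← dirichletSq_add_natCast P (-(l + f))]
    congr 1
    ring

lemma sum_transform_sdiff_le (P : ℕ) (hP : 0 < P) (θ f : ℝ) (hf : f = P * θ / Real.pi)
    (w : ℕ → ℂ)
    (hw : ∀ l, w l = (1 / (Real.sqrt P : ℂ)) * ∑ m ∈ range P,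
        Complex.exp (2 * (Real.pi : ℂ) * Complex.I * m * l / P)
          * (Real.sin ((2 * m + 1) * θ) : ℂ))
    (S : Finset ℕ) (hSP : S ⊆ range P) (hS : ∀ a ∈ S, (P - a) % P ∈ S) :
    ∑ l ∈ range P \ S, ‖w l‖ ^ 2 ≤ P - 1 / P * ∑ l ∈ S, dirichletSq P (l - f) := by
  have hP' : (P : ℝ) ≠ 0 := by exact_mod_cast hP.ne'
  have hsymm : ∑ l ∈ range P \ S, dirichletSq P (l + f)
      = ∑ l ∈ range P \ S, dirichletSq P (l - f) :=
    (sum_congr rfl fun l hl ↦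
      (dirichletSq_reflect P (mem_range.1 (mem_sdiff.1 hl).1) f).symm).trans
      (sum_sdiff_reflect P hP S hS fun l ↦ dirichletSq P (l - f))
  have htot := sum_sdiff hSP (f := fun l : ℕ ↦ dirichletSq P (l - f))
  rw [sum_dirichletSq P hP] at htot
  calc _ ≤ ∑ l ∈ range P \ S,
        1 / (2 * (P : ℝ)) * (dirichletSq P (l - f) + dirichletSq P (l + f)) := by
        refine sum_le_sum fun l _ ↦ ?_
        rw [hw l]
        exact norm_sq_transform_le P hP θ f hf l
    _ = 1 / P * ∑ l ∈ range P \ S, dirichletSq P (l - f) := by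
        rw [← mul_sum, sum_add_distrib, hsymm]
        field_simp
        ring
    _ = _ := by
        rw [eq_sub_of_add_eq htot]
        field_simp

lemma le_dirichletSq_int_sub (P : ℕ) (hP : 0 < P) {f t : ℝ} {j : ℕ} (hf : f = j + t) {k : ℤ}
    (hk : (k : ℝ) - f ≠ 0) :
    (P : ℝ) ^ 2 * (Real.sin (Real.pi * t) ^ 2 / Real.pi ^ 2 * (1 / (k - f) ^ 2))
      ≤ dirichletSq P (k - f) := by
  have hsin : Real.sin (Real.pi * (k - f)) ^ 2 = Real.sin (Real.pi * t) ^ 2 := by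
    rw [Real.sin_sq_eq_half_sub, Real.sin_sq_eq_half_sub,
      show 2 * (Real.pi * (k - f)) = ((k - j : ℤ) : ℝ) * (2 * Real.pi) - 2 * (Real.pi * t) by
        rw [hf]; push_cast; ring, Real.cos_int_mul_two_pi_sub]
  have := le_dirichletSq P hP hk
  rwa [hsin] at this

lemma sum_sin_sq_eq (P : ℕ) (hP : 0 < P) {θ f t : ℝ} {j : ℕ} (hf : f = P * θ / Real.pi)
    (hft : f = j + t) (hθ : Real.sin (2 * θ) ≠ 0) :
    ∑ m ∈ range P, Real.sin ((2 * m + 1) * θ) ^ 2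
      = P / 2 - Real.sin (4 * Real.pi * t) / (4 * Real.sin (2 * θ)) := by
  have h := sum_sin_sq P θ
  have hy : Real.sin (4 * P * θ) = Real.sin (4 * Real.pi * t) := by
    rw [← Real.sin_add_nat_mul_two_pi (4 * Real.pi * t) (2 * j)]
    congr 1
    have : P * θ = f * Real.pi := by rw [hf]; field_simp
    push_cast
    linear_combination 4 * this + 4 * Real.pi * hft
  rw [hy] at h
  field_simp
  linear_combination 2 * h

lemma frequencies_zero {P : ℕ} (hP : 1 < P) :
    ({0 % P, (0 + 1) % P, (P - 0) % P, (P - (0 + 1)) % P} : Finset ℕ) = {0, 1, P - 1} := by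
  rw [zero_add, Nat.sub_zero, Nat.mod_self, Nat.zero_mod, Nat.mod_eq_of_lt (by omega),
    Nat.mod_eq_of_lt (by omega)]
  ext a
  simp only [mem_insert, mem_singleton]
  tauto

lemma frequencies_of_pos {P j : ℕ} (hj : 0 < j) (hjP : j + 1 < P) :
    ({j % P, (j + 1) % P, (P - j) % P, (P - (j + 1)) % P} : Finset ℕ)
      = {j, j + 1, P - j, P - (j + 1)} := by
  rw [Nat.mod_eq_of_lt (by omega), Nat.mod_eq_of_lt (by omega), Nat.mod_eq_of_lt (by omega),
    Nat.mod_eq_of_lt (by omega)]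

lemma frequencies_reflect {P j : ℕ} (hP : 1 < P) (hjP : j + 1 < P) :
    ∀ a ∈ ({j % P, (j + 1) % P, (P - j) % P, (P - (j + 1)) % P} : Finset ℕ),
      (P - a) % P ∈ ({j % P, (j + 1) % P, (P - j) % P, (P - (j + 1)) % P} : Finset ℕ) := by
  intro a ha
  rcases Nat.eq_zero_or_pos j with rfl | h
  · rw [frequencies_zero hP] at ha ⊢
    simp only [mem_insert, mem_singleton] at ha ⊢
    rcases ha with rfl | rfl | rfl
    · simp
    · rw [Nat.mod_eq_of_lt (by omega)]; omega
    · rw [Nat.mod_eq_of_lt (by omega)]; omega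
  · rw [frequencies_of_pos h hjP] at ha ⊢
    simp only [mem_insert, mem_singleton] at ha ⊢
    rw [Nat.mod_eq_of_lt (by omega)]
    omega

lemma sin_four_pi_mul_le_of_le_quarter {t : ℝ} (ht : t ≤ 1 / 4) :
    Real.sin (4 * Real.pi * t) ≤ 12.5664 * (1 / 4 - t) := by
  have hpi := Real.pi_pos
  have h := Real.sin_le (x := Real.pi - 4 * Real.pi * t) (by nlinarith)
  rw [Real.sin_pi_sub] at h
  nlinarith [Real.pi_lt_d4]

lemma sin_four_pi_mul_le_of_half_le {t : ℝ} (ht : 1 / 2 ≤ t) :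
    Real.sin (4 * Real.pi * t) ≤ 12.5664 * (t - 1 / 2) := by
  have hpi := Real.pi_pos
  have h := Real.sin_le (x := 4 * Real.pi * t - 2 * Real.pi) (by nlinarith)
  rw [Real.sin_sub_two_pi] at h
  nlinarith [Real.pi_lt_d4]

lemma le_ten_mul_div_mul {y z c x : ℝ} (hc : 0 < c) (hz : 0 ≤ z) (hyz : y ≤ z)
    (hx : 4 * c ≤ x) : y ≤ 10 * (z / (40 * c)) * x := by
  calc y ≤ z := hyz
    _ = 10 * (z / (40 * c)) * (4 * c) := by field_simp; ring
    _ ≤ _ := by gcongr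

set_option maxHeartbeats 600000 in
/-- Non-integer frequency case of quantum counting: the squared norm of the discrete Fourier
transform `w` of `v_m = sin((2m+1)θ)` outside the four frequencies
`⌊f⌋, ⌈f⌉, P−⌊f⌋, P−⌈f⌉` (taken mod `P`) is less than `2/5` of the total squared norm. -/
theorem stmt13 (P : ℕ) (hP : 4 ≤ P)
    (θ : ℝ) (hθ0 : 0 < θ) (hθ1 : θ < Real.pi / 2)
    (f : ℝ) (hf : f = P * θ / Real.pi)
    (hf0 : 0 < f) (hfP : f < P / 2) (hfint : ∀ n : ℤ, f ≠ n)
    (v : ℕ → ℂ) (hv : ∀ m, v m = (Real.sin ((2 * m + 1) * θ) : ℂ))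
    (w : ℕ → ℂ)
    (hw : ∀ l, w l = (1 / (Real.sqrt P : ℂ))
        * ∑ m ∈ range P, Complex.exp (2 * (Real.pi : ℂ) * Complex.I * m * l / P) * v m)
    (S : Finset ℕ)
    (hS : S = {⌊f⌋₊ % P, ⌈f⌉₊ % P, (P - ⌊f⌋₊) % P, (P - ⌈f⌉₊) % P}) :
    ∑ l ∈ range P \ S, ‖w l‖ ^ 2
      < (2 / 5) * ∑ m ∈ range P, ‖v m‖ ^ 2 := by
  have hpi := Real.pi_pos
  have hP0 : 0 < P := by omega
  have hPR : (0 : ℝ) < P := by exact_mod_cast hP0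
  have hP4 : (4 : ℝ) ≤ P := by exact_mod_cast hP
  obtain ⟨j, hj⟩ : ∃ j, ⌊f⌋₊ = j := ⟨_, rfl⟩
  have hjf : (j : ℝ) ≤ f := hj ▸ Nat.floor_le hf0.le
  have hjf' : f < j + 1 := hj ▸ Nat.lt_floor_add_one f
  have hjne : f ≠ j := by exact_mod_cast hfint j
  have hceil : ⌈f⌉₊ = j + 1 := by
    rw [Nat.ceil_eq_iff (by omega)]
    rw [Nat.add_sub_cancel]
    push_cast
    exact ⟨lt_of_le_of_ne hjf hjne.symm, hjf'.le⟩
  rw [hj, hceil] at hS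
  have hjP : 2 * j + 1 ≤ P := by
    have : (2 * j : ℝ) < P := by linarith
    have : 2 * j < P := by exact_mod_cast this
    omega
  have hjPR : (2 * j + 1 : ℝ) ≤ P := by exact_mod_cast hjP
  obtain ⟨t, ht⟩ : ∃ t, t = f - j := ⟨_, rfl⟩
  have hft : f = j + t := by linarith
  have ht0 : 0 < t := by
    rw [ht, sub_pos]
    exact lt_of_le_of_ne hjf hjne.symm
  have ht1 : t < 1 := by linarith
  have hSP : S ⊆ range P := by
    rw [hS]
    intro a ha
    simp only [mem_insert, mem_singleton] at ha
    rcases ha with rfl | rfl | rfl | rfl <;> exact mem_range.2 (Nat.mod_lt _ hP0)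
  have hS0 : j = 0 → S = {0, 1, P - 1} := by
    rintro rfl
    exact hS.trans (frequencies_zero (by omega))
  have hS1 : 1 ≤ j → S = {j, j + 1, P - j, P - (j + 1)} := fun h ↦
    hS.trans (frequencies_of_pos h (by omega))
  have hSrefl : ∀ a ∈ S, (P - a) % P ∈ S := by
    rw [hS]
    exact frequencies_reflect (by omega) (by omega)
  obtain ⟨s, hs⟩ : ∃ s, s = Real.sin (Real.pi * t) ^ 2 / Real.pi ^ 2 := ⟨_, rfl⟩
  have hsc := sin_sq_lower_center ht0.le ht1.le
  have hse := sin_sq_lower_end ht0.le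
  have hse' := sin_sq_lower_end (t := 1 - t) (by linarith)
  rw [show Real.pi * (1 - t) = Real.pi - Real.pi * t by ring, Real.sin_pi_sub] at hse'
  rw [← hs] at hsc hse hse'
  have hD : ∀ k : ℤ, (k : ℝ) - f ≠ 0 →
      (P : ℝ) ^ 2 * (s * (1 / (k - f) ^ 2)) ≤ dirichletSq P (k - f) := fun k hk ↦
    hs ▸ le_dirichletSq_int_sub P hP0 hft hk
  have hDj := hD j (by push_cast; rw [hft]; simpa using ht0.ne')
  have hDj1 := hD (j + 1) (by push_cast; linarith)
  have hDnn : ∀ x, 0 ≤ dirichletSq P x := fun x ↦ sq_nonneg _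
  rw [show ((j : ℤ) : ℝ) - f = -t by rw [hft]; push_cast; ring, neg_sq] at hDj
  rw [show ((j + 1 : ℤ) : ℝ) - f = 1 - t by rw [hft]; push_cast; ring] at hDj1
  obtain ⟨y, hy⟩ : ∃ y, y = Real.sin (4 * Real.pi * t) := ⟨_, rfl⟩
  have hθs : 0 < Real.sin (2 * θ) := Real.sin_pos_of_pos_of_lt_pi (by linarith) (by linarith)
  have htotal : ∑ m ∈ range P, ‖v m‖ ^ 2 = P / 2 - y / (4 * Real.sin (2 * θ)) := by
    rw [hy, ← sum_sin_sq_eq P hP0 hf hft hθs.ne']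
    exact sum_congr rfl fun m _ ↦ by rw [hv, Complex.norm_real, Real.norm_eq_abs, sq_abs]
  have main : ∀ R C : ℝ, (P : ℝ) ^ 2 * (s * C) ≤ ∑ l ∈ S, dirichletSq P (l - f) →
      y ≤ 10 * R * (P * Real.sin (2 * θ)) → 4 / 5 + R < s * C →
      ∑ l ∈ range P \ S, ‖w l‖ ^ 2 < (2 / 5) * ∑ m ∈ range P, ‖v m‖ ^ 2 := by
    intro R C h1 h2 h3
    refine (sum_transform_sdiff_le P hP0 θ f hf w (fun l ↦ by simp only [hw, hv]) S hSP
      hSrefl).trans_lt ?_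
    have h4 : P * (s * C) ≤ 1 / P * ∑ l ∈ S, dirichletSq P (l - f) := by
      calc _ = 1 / P * ((P : ℝ) ^ 2 * (s * C)) := by field_simp
        _ ≤ _ := by gcongr
    have h5 : y / (4 * Real.sin (2 * θ)) ≤ 5 / 2 * R * P := by
      rw [div_le_iff₀ (by positivity)]
      linarith
    have h6 := mul_lt_mul_of_pos_left h3 hPR
    rw [htotal]
    linarith
  have hjS : j ∈ S ∧ j + 1 ∈ S := by
    rw [hS, Nat.mod_eq_of_lt (show j < P by omega), Nat.mod_eq_of_lt (show j + 1 < P by omega)]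
    simp
  have htwo : (P : ℝ) ^ 2 * (s * (1 / t ^ 2 + 1 / (1 - t) ^ 2))
      ≤ ∑ l ∈ S, dirichletSq P (l - f) := by
    have hsub : ({j, j + 1} : Finset ℕ) ⊆ S := by
      simp [insert_subset_iff, hjS]
    refine le_trans ?_ (sum_le_sum_of_subset_of_nonneg hsub fun _ _ _ ↦ hDnn _)
    rw [sum_pair (by omega), show (j : ℝ) - f = -t by linarith, dirichletSq_neg,
      show ((j + 1 : ℕ) : ℝ) - f = 1 - t by push_cast; linarith]
    rw [dirichletSq_neg] at hDj
    linarith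
  have hthree : ∀ d, ∀ l ∈ S, l ≠ j → l ≠ j + 1 →
      (P : ℝ) ^ 2 * (s * (1 / d ^ 2)) ≤ dirichletSq P (l - f) →
      (P : ℝ) ^ 2 * (s * (1 / t ^ 2 + 1 / (1 - t) ^ 2 + 1 / d ^ 2))
      ≤ ∑ l ∈ S, dirichletSq P (l - f) := by
    intro d l hl hl1 hl2 h
    have hsub : ({l, j, j + 1} : Finset ℕ) ⊆ S := by
      simp [insert_subset_iff, hjS, hl]
    refine le_trans ?_ (sum_le_sum_of_subset_of_nonneg hsub fun _ _ _ ↦ hDnn _)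
    rw [sum_insert (by simp [hl1, hl2]), sum_pair (by omega), show (j : ℝ) - f = -t by linarith,
      dirichletSq_neg, show ((j + 1 : ℕ) : ℝ) - f = 1 - t by push_cast; linarith]
    rw [dirichletSq_neg] at hDj
    linarith
  have hleft : j = 0 → (P : ℝ) ^ 2 * (s * (1 / t ^ 2 + 1 / (1 - t) ^ 2 + 1 / (1 + t) ^ 2))
      ≤ ∑ l ∈ S, dirichletSq P (l - f) := by
    intro h
    refine hthree (1 + t) (P - 1) (by simp [hS0 h]) (by omega) (by omega) ?_
    have hd := hD (-1) (by push_cast; linarith)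
    rw [← dirichletSq_add_natCast] at hd
    subst h
    convert hd using 2
    · rw [hft]; push_cast; ring
    · rw [Nat.cast_sub (by omega)]; push_cast; ring
  rcases le_or_gt y 0 with hy0 | hy0
  · exact main 0 _ htwo (by simpa using hy0) (by simpa using two_terms ht0 ht1 hsc hse hse')
  have hyone : y ≤ 1 := hy ▸ Real.sin_le_one _
  rcases mem_of_sin_four_pi_mul_pos ht0 ht1 (hy ▸ hy0) with h4 | ⟨h2, h3⟩
  · rcases Nat.eq_zero_or_pos j with h | h
    · refine main _ _ (hleft h) ?_ (three_terms_near_zero ht0 h4 hse)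
      have hyle := sin_four_pi_mul_le ht0.le h4
      have hsle := four_mul_sin_le_mul_sin hP4 ht0.le (by linarith)
      rw [show Real.pi * t / P = θ by
        rw [show t = f by rw [hft, h]; simp, hf]; field_simp] at hsle
      rw [hy]
      refine hyle.trans ?_
      have : 0 ≤ (1 - 8 * t ^ 2) * (1 - 2 * t ^ 2) :=
        mul_nonneg (by nlinarith) (by nlinarith)
      have := mul_le_mul_of_nonneg_left hsle this
      linarith
    · have h1j : (1 : ℝ) ≤ j := by exact_mod_cast h
      have hy4 : y ≤ 12.5664 * (1 / 4 - t) := hy ▸ sin_four_pi_mul_le_of_le_quarter h4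
      refine main _ _ htwo ?_ (two_terms_left ht0 h4 hse hy4)
      have hc := four_mul_le_mul_sin hPR hf (c := 1 / 2 - t) (by linarith) (by linarith)
        (by linarith)
      exact le_ten_mul_div_mul (by linarith) hy0.le le_rfl hc
  · rcases Nat.eq_zero_or_pos j with h | h
    · refine main _ _ (hleft h) ?_ (three_terms_left h2 h3 hsc)
      have hc := four_mul_le_mul_sin hPR hf (c := t) (by linarith)
        (by rw [hft, h]; simp) (by rw [hft, h]; push_cast; linarith)
      exact le_ten_mul_div_mul ht0 zero_le_one hyone hc
    have h1j : (1 : ℝ) ≤ j := by exact_mod_cast h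
    have hP2 : 2 * j + 2 ≤ P := by
      have : (2 * j + 1 : ℝ) < P := by linarith
      have : 2 * j + 1 < P := by exact_mod_cast this
      omega
    have hP2R : (2 * j + 2 : ℝ) ≤ P := by exact_mod_cast hP2
    rcases le_or_gt P (2 * j + 3) with hP3 | hP3
    · have hmem : j + 2 ∈ S := by
        rw [hS1 h]
        simp only [mem_insert, mem_singleton]
        omega
      have hd := hD (j + 2) (by push_cast; linarith)
      refine main _ _ (hthree (2 - t) (j + 2) hmem (by omega) (by omega) ?_) ?_
        (three_terms_right h2 h3 hsc)
      · rw [show ((j + 2 : ℤ) : ℝ) - f = 2 - t by rw [hft]; push_cast; ring] at hd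
        rwa [show ((j + 2 : ℕ) : ℝ) - f = 2 - t by rw [hft]; push_cast; ring]
      · have hc := four_mul_le_mul_sin hPR hf (c := 1 - t) (by linarith) (by linarith)
          (by linarith)
        exact le_ten_mul_div_mul (by linarith) zero_le_one hyone hc
    · have hP4R : (2 * j + 4 : ℝ) ≤ P := by exact_mod_cast hP3
      have hy4 : y ≤ 12.5664 * (t - 1 / 2) := hy ▸ sin_four_pi_mul_le_of_half_le h2
      refine main _ _ htwo ?_ (two_terms_right h2 h3 hsc)
      have hc := four_mul_le_mul_sin hPR hf (c := 2 - t) (by linarith) (by linarith) (by linarith)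
      exact le_ten_mul_div_mul (by linarith) (hy0.le.trans hy4) hy4 hc
end
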